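/- arXiv:q-alg/9704004 — 2 statements merged into one kernel-verified Lean document; each statement's English description precedes it below -/
import Mathlib

section
/- For all integers n ≥ 1 and l ≥ 1: if E_n(l) contains a nontrivial modular set, then l ≤ 13.7^n. In particular, for each fixed n there are only finitely many l such that E_n(l) contains a nontrivial modular set. -/
open Complex Filter Topology UpperHalfPlane Matrix MatrixGroups
open scoped Real Manifold

noncomputable section

/-- `B(x) = y² − y + 1/6` where `y` is the fractional part of `x`. -/
def bern (x : ℝ) : ℝ := Int.fract x ^ 2 - Int.fract x + 1 / 6

/-- The modular unit `[r]_l`. -/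
def rl (l r : ℤ) : UpperHalfPlane → ℂ := fun z =>
  Complex.exp (2 * (π : ℂ) * Complex.I *
      ((-((l : ℝ) * bern ((r : ℝ) / (l : ℝ)) / 2) : ℝ) : ℂ) * (z : ℂ)) *
    (∏' n : {n : ℤ // 0 < n ∧ n ≡ r [ZMOD l]},
      (1 - Complex.exp (2 * (π : ℂ) * Complex.I * ((n : ℤ) : ℂ) * (z : ℂ)))⁻¹) *
    (∏' n : {n : ℤ // 0 < n ∧ n ≡ -r [ZMOD l]},
      (1 - Complex.exp (2 * (π : ℂ) * Complex.I * ((n : ℤ) : ℂ) * (z : ℂ)))⁻¹)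

/-- `E_n(l)`: the set of all products `[r₁,…,r_k]_l = ∏_j [r_j]_l` with `0 ≤ k ≤ n` and
integers `r_j` not divisible by `l`. -/
def Enl (n l : ℕ) : Set (UpperHalfPlane → ℂ) :=
  {f | ∃ k : ℕ, k ≤ n ∧ ∃ r : Fin k → ℤ, (∀ j, ¬ (l : ℤ) ∣ r j) ∧
    f = fun z => ∏ j, rl l (r j) z}

/-- A modular set: a finite non-empty set of functions on `ℍ` whose (complex) span is
invariant under the action of `SL(2,ℤ)`. -/
def IsModularSet (S : Set (UpperHalfPlane → ℂ)) : Prop :=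
  S.Finite ∧ S.Nonempty ∧
  ∀ A : SL(2, ℤ), ∀ f ∈ Submodule.span ℂ S, (fun z => f (A • z)) ∈ Submodule.span ℂ S


/-! ### The one-sided products -/

/-- The double series for the logarithm of the product over one residue class. -/
def FF (l ρ : ℕ) (q : ℂ) (p : ℕ × ℕ) : ℂ := (q ^ (ρ + l * p.1)) ^ p.2 / (p.2 : ℂ)

lemma norm_FF_le {l ρ : ℕ} (hl : 1 ≤ l) (hρ : 1 ≤ ρ) {q : ℂ} (hq : ‖q‖ < 1) (p : ℕ × ℕ) :
    ‖FF l ρ q p‖ ≤ ‖q‖ ^ p.1 * ‖q‖ ^ p.2 := by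
  obtain ⟨j, m⟩ := p
  unfold FF
  rcases Nat.eq_zero_or_pos m with rfl | hm
  · simp
  · simp only [norm_div, norm_pow, ← pow_mul, ← pow_add, Complex.norm_natCast]
    have h1 : (1 : ℝ) ≤ m := by exact_mod_cast hm
    refine (div_le_self (by positivity) h1).trans ?_
    apply pow_le_pow_of_le_one (norm_nonneg _) hq.le
    nlinarith [Nat.mul_le_mul_right j hl, Nat.zero_le (l * j * (m - 1)),
      Nat.mul_le_mul_left (l * j) hm, Nat.mul_le_mul_right m hρ]

lemma summable_FF {l ρ : ℕ} (hl : 1 ≤ l) (hρ : 1 ≤ ρ) {q : ℂ} (hq : ‖q‖ < 1) :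
    Summable (FF l ρ q) := by
  refine Summable.of_norm_bounded (g := fun p : ℕ × ℕ => ‖q‖ ^ p.1 * ‖q‖ ^ p.2) ?_
    (norm_FF_le hl hρ hq)
  have h := summable_geometric_of_lt_one (norm_nonneg q) hq
  exact h.mul_of_nonneg h (fun _ => by positivity) (fun _ => by positivity)

/-- Logarithm of the product over one residue class. -/
def GG (l ρ : ℕ) (q : ℂ) : ℂ := ∑' p, FF l ρ q p

lemma pow_norm_lt {q : ℂ} (hq : ‖q‖ < 1) {k : ℕ} (hk : 1 ≤ k) : ‖q ^ k‖ < 1 := by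
  rw [norm_pow]
  exact pow_lt_one₀ (norm_nonneg _) hq (by omega)

lemma tprod_eq_exp_GG {l ρ : ℕ} (hl : 1 ≤ l) (hρ : 1 ≤ ρ) {q : ℂ} (hq : ‖q‖ < 1) :
    ∏' j : ℕ, (1 - q ^ (ρ + l * j))⁻¹ = Complex.exp (GG l ρ q) := by
  have hw (j : ℕ) : ‖q ^ (ρ + l * j)‖ < 1 := pow_norm_lt hq (by omega)
  have hlog (j : ℕ) : Complex.log (1 - q ^ (ρ + l * j))⁻¹ = -Complex.log (1 - q ^ (ρ + l * j)) := by
    apply Complex.log_inv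
    have hre : 0 < (1 - q ^ (ρ + l * j)).re := by
      have := (Complex.abs_re_le_norm (q ^ (ρ + l * j))).trans_lt (hw j)
      rw [abs_lt] at this
      simp only [Complex.sub_re, Complex.one_re]
      linarith
    intro h
    rw [Complex.arg_eq_pi_iff] at h
    linarith [h.1]
  have hs : HasSum (fun j : ℕ => Complex.log (1 - q ^ (ρ + l * j))⁻¹) (GG l ρ q) := by
    have h0 : HasSum (FF l ρ q) (GG l ρ q) := (summable_FF hl hρ hq).hasSum
    have h1 (j : ℕ) : HasSum (fun m : ℕ => FF l ρ q (j, m)) (-Complex.log (1 - q ^ (ρ + l * j))) := by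
      have h2 := Complex.hasSum_taylorSeries_neg_log (hw j)
      simpa only [FF] using h2
    simp only [hlog]
    exact HasSum.prod_fiberwise h0 h1
  rw [← Complex.cexp_tsum_eq_tprod _ hs.summable, hs.tsum_eq]
  intro j
  apply inv_ne_zero
  intro h
  have h2 := hw j
  rw [← sub_eq_zero.mp h] at h2
  simp at h2

lemma re_GG_le {l ρ : ℕ} (hl : 1 ≤ l) (hρ : 1 ≤ ρ) {q : ℂ} (hq : ‖q‖ < 1) :
    (GG l ρ q).re ≤ (GG l ρ (‖q‖ : ℂ)).re := by
  have hq' : ‖(‖q‖ : ℂ)‖ < 1 := by simpa using hq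
  refine hasSum_le ?_ (Complex.hasSum_re (summable_FF hl hρ hq).hasSum)
    (Complex.hasSum_re (summable_FF hl hρ hq').hasSum)
  intro p
  refine (Complex.re_le_norm _).trans (le_of_eq ?_)
  unfold FF
  have : ((‖q‖ : ℂ) ^ (ρ + l * p.1)) ^ p.2 / (p.2 : ℂ)
      = (((‖q‖ ^ (ρ + l * p.1)) ^ p.2 / (p.2 : ℝ) : ℝ) : ℂ) := by push_cast; rfl
  rw [this, Complex.ofReal_re]
  simp

lemma GG_eq {l ρ : ℕ} (hl : 1 ≤ l) (hρ : 1 ≤ ρ) {q : ℂ} (hq : ‖q‖ < 1) :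
    HasSum (fun m : ℕ => (q ^ ρ) ^ m / (1 - (q ^ l) ^ m) / (m : ℂ)) (GG l ρ q) := by
  have h := ((Equiv.prodComm ℕ ℕ).hasSum_iff).mpr (summable_FF hl hρ hq).hasSum
  refine h.prod_fiberwise fun m => ?_
  simp only [Function.comp_apply, Equiv.prodComm_apply, Prod.swap_prod_mk, FF]
  rcases Nat.eq_zero_or_pos m with rfl | hm
  · simp
  apply HasSum.div_const
  have h1 : ‖(q ^ l) ^ m‖ < 1 := pow_norm_lt (pow_norm_lt hq hl) hm
  have h2 := (hasSum_geometric_of_norm_lt_one h1).mul_left ((q ^ ρ) ^ m)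
  rw [← div_eq_mul_inv] at h2
  have h3 : (fun j : ℕ => (q ^ (ρ + l * j)) ^ m)
      = fun j : ℕ => (q ^ ρ) ^ m * ((q ^ l) ^ m) ^ j := by
    funext j
    ring
  rw [h3]
  exact h2

/-! ### Asymptotics at rational points -/

lemma hasSum_congr_real {f g : ℕ → ℝ} {a b : ℝ} (h : HasSum g b) (hfg : ∀ m, f m = g m)
    (hab : a = b) : HasSum f a := by
  rw [hab, funext hfg]
  exact h

lemma hasSum_bern (x : ℝ) :
    HasSum (fun m : ℕ => Real.cos (2 * π * m * x) / (m : ℝ) ^ 2) (π ^ 2 * bern x) := by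
  have hx : Int.fract x ∈ Set.Icc (0 : ℝ) 1 := ⟨Int.fract_nonneg x, (Int.fract_lt_one x).le⟩
  have h := hasSum_one_div_nat_pow_mul_cos one_ne_zero hx
  have hv : (-1 : ℝ) ^ (1 + 1) * (2 * π) ^ (2 * 1) / 2 / (Nat.factorial (2 * 1) : ℝ) *
      (Polynomial.map (algebraMap ℚ ℝ) (Polynomial.bernoulli (2 * 1))).eval (Int.fract x)
      = π ^ 2 * bern x := by
    have hb : (Polynomial.map (algebraMap ℚ ℝ) (Polynomial.bernoulli (2 * 1))).eval (Int.fract x)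
        = bern x := by
      simp only [bern, Polynomial.bernoulli, Finset.sum_range_succ, Polynomial.map_add,
        Polynomial.map_monomial, Polynomial.eval_add, Polynomial.eval_monomial]
      norm_num [bernoulli_eq_bernoulli'_of_ne_one, bernoulli_one, Nat.choose]
      ring
    rw [hb]
    simp only [Nat.factorial]
    push_cast
    ring
  rw [hv] at h
  refine hasSum_congr_real h (fun m => ?_) rfl
  have : 2 * π * m * x = 2 * π * m * Int.fract x + ((m * ⌊x⌋ : ℤ) : ℝ) * (2 * π) := by
    conv_lhs => rw [← Int.fract_add_floor x]
    push_cast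
    ring
  rw [this, Real.cos_add_int_mul_two_pi]
  ring

lemma tendsto_aux (a : ℝ) {b : ℝ} (hb : 0 < b) :
    Tendsto (fun t : ℝ => t * Real.exp (-(a * t)) / (1 - Real.exp (-(b * t)))) (𝓝[>] 0)
      (𝓝 (1 / b)) := by
  have h1 : HasDerivAt (fun t : ℝ => 1 - Real.exp (-(b * t))) b 0 := by
    have h2 : HasDerivAt (fun t : ℝ => -(b * t)) (-b) 0 := by
      have h5 := (hasDerivAt_id (0 : ℝ)).const_mul (-b)
      rw [mul_one] at h5
      exact h5.congr_of_eventuallyEq (Eventually.of_forall fun t => by simp)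
    simpa using h2.exp.const_sub 1
  have h3 := (h1.tendsto_slope_zero_right).inv₀ hb.ne'
  have h4 : Tendsto (fun t : ℝ => Real.exp (-(a * t))) (𝓝[>] 0) (𝓝 1) := by
    have : Continuous (fun t : ℝ => Real.exp (-(a * t))) := by fun_prop
    have h5 := this.tendsto 0
    simp only [mul_zero, neg_zero, Real.exp_zero] at h5
    exact h5.mono_left nhdsWithin_le_nhds
  have h6 := h4.mul h3
  rw [one_mul, ← one_div] at h6
  refine h6.congr fun t => ?_
  simp only [zero_add, mul_zero, neg_zero, Real.exp_zero, sub_self, sub_zero, smul_eq_mul, mul_inv,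
    inv_inv]
  ring

lemma bound_aux {l ρ m : ℕ} (hl : 1 ≤ l) (hρ : 1 ≤ ρ) (hm : 1 ≤ m) {t : ℝ} (ht : 0 < t) :
    0 ≤ t * Real.exp (-(2 * π * ρ * m * t)) / (1 - Real.exp (-(2 * π * l * m * t))) ∧
    t * Real.exp (-(2 * π * ρ * m * t)) / (1 - Real.exp (-(2 * π * l * m * t)))
      ≤ 1 / (2 * π * m) := by
  have hl' : (1 : ℝ) ≤ l := by exact_mod_cast hl
  have hρ' : (1 : ℝ) ≤ ρ := by exact_mod_cast hρ
  have hm' : (0 : ℝ) < m := by exact_mod_cast hm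
  have hπ := Real.pi_pos
  set v : ℝ := 2 * π * m * t with hv
  have hvpos : 0 < v := by positivity
  have e1 : Real.exp (-(2 * π * l * m * t)) ≤ Real.exp (-v) := by
    apply Real.exp_le_exp.mpr
    have : 2 * π * l * m * t = l * v := by rw [hv]; ring
    rw [this]; nlinarith
  have e2 : Real.exp (-(2 * π * ρ * m * t)) ≤ Real.exp (-v) := by
    apply Real.exp_le_exp.mpr
    have : 2 * π * ρ * m * t = ρ * v := by rw [hv]; ring
    rw [this]; nlinarith
  have e3 : Real.exp (-v) < 1 := by rw [Real.exp_lt_one_iff]; linarith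
  have e4 : v * Real.exp (-v) ≤ 1 - Real.exp (-v) := by
    have h := Real.add_one_le_exp v
    have h5 : Real.exp v * Real.exp (-v) = 1 := by rw [← Real.exp_add]; simp
    nlinarith [Real.exp_pos (-v)]
  have hden : 0 < 1 - Real.exp (-(2 * π * l * m * t)) := by linarith
  refine ⟨by positivity, ?_⟩
  rw [div_le_div_iff₀ hden (by positivity)]
  have : t * Real.exp (-(2 * π * ρ * m * t)) * (2 * π * m)
      = v * Real.exp (-(2 * π * ρ * m * t)) := by rw [hv]; ring
  rw [this, one_mul]
  nlinarith

/-- The nome at `z`. -/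
def qq (z : ℂ) : ℂ := Complex.exp (2 * (π : ℂ) * Complex.I * z)

lemma norm_qq (z : ℂ) : ‖qq z‖ = Real.exp (-(2 * π * z.im)) := by
  rw [qq, Complex.norm_exp]
  congr 1
  simp

lemma norm_qq_lt {z : ℂ} (hz : 0 < z.im) : ‖qq z‖ < 1 := by
  rw [norm_qq, Real.exp_lt_one_iff]
  have := Real.pi_pos
  have : 0 < 2 * π * z.im := by positivity
  linarith

lemma re_term (l ρ m : ℕ) (hl : 1 ≤ l) (p : ℤ) (t : ℝ) :
    ((qq (((p / l : ℝ) : ℂ) + t * Complex.I) ^ ρ) ^ m /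
      (1 - (qq (((p / l : ℝ) : ℂ) + t * Complex.I) ^ l) ^ m) / (m : ℂ)).re
    = Real.cos (2 * π * m * (ρ * (p / l))) * (Real.exp (-(2 * π * ρ * m * t)) /
        (1 - Real.exp (-(2 * π * l * m * t)))) / m := by
  have hl' : (l : ℂ) ≠ 0 := by
    have : l ≠ 0 := by omega
    exact_mod_cast this
  have h1 : (qq (((p / l : ℝ) : ℂ) + t * Complex.I) ^ l) ^ m
      = ((Real.exp (-(2 * π * l * m * t)) : ℝ) : ℂ) := by
    rw [qq, ← pow_mul, ← Complex.exp_nat_mul, Complex.ofReal_exp, Complex.exp_eq_exp_iff_exists_int]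
    refine ⟨m * p, ?_⟩
    push_cast
    field_simp
    ring_nf
    simp only [Complex.I_sq]
    ring
  have h2 : (qq (((p / l : ℝ) : ℂ) + t * Complex.I) ^ ρ) ^ m
      = Complex.exp (((-(2 * π * ρ * m * t) : ℝ) : ℂ)
          + ((2 * π * m * (ρ * (p / l)) : ℝ) : ℂ) * Complex.I) := by
    rw [qq, ← pow_mul, ← Complex.exp_nat_mul]
    congr 1
    push_cast
    ring_nf
    simp only [Complex.I_sq]
    ring
  rw [h1, h2]
  have h3 : (1 : ℂ) - ((Real.exp (-(2 * π * l * m * t)) : ℝ) : ℂ)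
      = ((1 - Real.exp (-(2 * π * l * m * t)) : ℝ) : ℂ) := by push_cast; rfl
  rw [h3, ← Complex.ofReal_natCast m, Complex.div_ofReal_re, Complex.div_ofReal_re,
    Complex.exp_re]
  simp
  ring

lemma tendsto_GG {l ρ : ℕ} (hl : 1 ≤ l) (hρ : 1 ≤ ρ) (p : ℤ) :
    Tendsto (fun t : ℝ => t * (GG l ρ (qq (((p / l : ℝ) : ℂ) + t * Complex.I))).re) (𝓝[>] 0)
      (𝓝 (π * bern (ρ * (p / l)) / (2 * l))) := by
  have hl' : (0 : ℝ) < l := by exact_mod_cast hl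
  have hπ := Real.pi_pos
  set T : ℝ → ℕ → ℝ := fun t m => Real.cos (2 * π * m * (ρ * (p / l))) *
    (t * Real.exp (-(2 * π * ρ * m * t)) / (1 - Real.exp (-(2 * π * l * m * t)))) / m with hT
  have hsum : ∀ t : ℝ, 0 < t →
      ∑' m, T t m = t * (GG l ρ (qq (((p / l : ℝ) : ℂ) + t * Complex.I))).re := by
    intro t ht
    have hq : ‖qq (((p / l : ℝ) : ℂ) + t * Complex.I)‖ < 1 := by
      apply norm_qq_lt
      rw [Complex.add_im, Complex.ofReal_im]
      simpa using ht
    have h := (Complex.hasSum_re (GG_eq hl hρ hq)).mul_left t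
    refine HasSum.tsum_eq ?_
    refine hasSum_congr_real h (fun m => ?_) rfl
    rw [re_term l ρ m hl p t, hT]
    ring
  have hlim : ∑' m : ℕ, Real.cos (2 * π * m * (ρ * (p / l))) * (1 / (2 * π * l * m)) / m
      = π * bern (ρ * (p / l)) / (2 * l) := by
    refine HasSum.tsum_eq ?_
    refine hasSum_congr_real ((hasSum_bern (ρ * (p / l))).mul_left (1 / (2 * π * l)))
      (fun m => ?_) ?_
    · ring
    · field_simp
  rw [← hlim]
  have key : Tendsto (fun t : ℝ => ∑' m, T t m) (𝓝[>] 0)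
      (𝓝 (∑' m : ℕ, Real.cos (2 * π * m * (ρ * (p / l))) * (1 / (2 * π * l * m)) / m)) := by
    refine tendsto_tsum_of_dominated_convergence
      (bound := fun m : ℕ => 1 / (2 * π) * (1 / (m : ℝ) ^ 2)) ?_ ?_ ?_
    · exact (Real.summable_one_div_nat_pow.mpr (by norm_num)).mul_left _
    · intro m
      rcases Nat.eq_zero_or_pos m with rfl | hm
      · simp [hT]
      · have hm' : (0 : ℝ) < m := by exact_mod_cast hm
        exact ((tendsto_aux (2 * π * ρ * m) (b := 2 * π * l * m) (by positivity)).const_mul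
          _).div_const _
    · filter_upwards [self_mem_nhdsWithin] with t ht m
      rcases Nat.eq_zero_or_pos m with rfl | hm
      · simp [hT]
      · have hm' : (0 : ℝ) < m := by exact_mod_cast hm
        obtain ⟨b1, b2⟩ := bound_aux hl hρ hm (Set.mem_Ioi.mp ht)
        rw [hT, norm_div, norm_mul, Real.norm_of_nonneg b1, Real.norm_of_nonneg hm'.le]
        have hc : ‖Real.cos (2 * π * m * (ρ * (p / l)))‖ ≤ 1 := Real.abs_cos_le_one _
        calc _ ≤ 1 * (1 / (2 * π * m)) / m := by gcongr
          _ = _ := by field_simp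
  refine key.congr' ?_
  filter_upwards [self_mem_nhdsWithin] with t ht using hsum t ht

/-! ### The functions `[r]_l` -/

lemma bern_add_int (x : ℝ) (s : ℤ) : bern (x + s) = bern x := by
  simp [bern]

lemma bern_neg (x : ℝ) : bern (-x) = bern x := by
  unfold bern
  by_cases h : Int.fract x = 0
  · rw [Int.fract_neg_eq_zero.mpr h, h]
  · rw [Int.fract_neg h]
    ring

/-- Positive integers in a residue class, enumerated. -/
def classMap (l ρ : ℕ) (r : ℤ) (hρ : 1 ≤ ρ) (hr : (ρ : ℤ) ≡ r [ZMOD l]) :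
    ℕ → {n : ℤ // 0 < n ∧ n ≡ r [ZMOD l]} := fun j =>
  ⟨((ρ + l * j : ℕ) : ℤ), by
    constructor
    · have : 0 < ρ + l * j := by omega
      exact_mod_cast this
    · push_cast
      exact (Int.modEq_iff_dvd.mpr ⟨-(j : ℤ), by ring⟩ : _ ≡ (ρ : ℤ) [ZMOD l]).trans hr⟩

lemma classMap_bij {l ρ : ℕ} {r : ℤ} (hρ : 1 ≤ ρ) (hl : ρ ≤ l) (hr : (ρ : ℤ) ≡ r [ZMOD l]) :
    Function.Bijective (classMap l ρ r hρ hr) := by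
  constructor
  · intro i j h
    have h1 : ((ρ + l * i : ℕ) : ℤ) = ((ρ + l * j : ℕ) : ℤ) := congrArg Subtype.val h
    have h2 : ρ + l * i = ρ + l * j := by exact_mod_cast h1
    have h3 : l * i = l * j := by omega
    exact Nat.eq_of_mul_eq_mul_left (by omega) h3
  · rintro ⟨n, hn, hnr⟩
    obtain ⟨s, hs⟩ := (hr.trans hnr.symm).dvd
    have hs0 : 0 ≤ s := by
      by_contra hneg
      have : s ≤ -1 := by omega
      have hl' : (ρ : ℤ) ≤ l := by exact_mod_cast hl
      nlinarith
    refine ⟨s.toNat, Subtype.ext ?_⟩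
    change ((ρ + l * s.toNat : ℕ) : ℤ) = n
    push_cast
    rw [Int.toNat_of_nonneg hs0]
    linarith

lemma class_tprod {l ρ : ℕ} {r : ℤ} (hρ : 1 ≤ ρ) (hl : ρ ≤ l) (hr : (ρ : ℤ) ≡ r [ZMOD l])
    {z : ℂ} (hz : 0 < z.im) :
    (∏' n : {n : ℤ // 0 < n ∧ n ≡ r [ZMOD l]},
      (1 - Complex.exp (2 * (π : ℂ) * Complex.I * ((n : ℤ) : ℂ) * z))⁻¹)
    = Complex.exp (GG l ρ (qq z)) := by
  rw [← tprod_eq_exp_GG (by omega) hρ (norm_qq_lt hz),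
    ← (Equiv.ofBijective _ (classMap_bij hρ hl hr)).tprod_eq]
  congr 1
  funext j
  have : (((Equiv.ofBijective _ (classMap_bij hρ hl hr)) j : ℤ) : ℂ) = ((ρ + l * j : ℕ) : ℂ) := by
    simp [classMap]
  rw [this, qq, ← Complex.exp_nat_mul]
  congr 3
  ring

lemma exists_rep {l : ℕ} {r : ℤ} (hr : ¬ (l : ℤ) ∣ r) (hl : 1 ≤ l) :
    ∃ ρ : ℕ, 1 ≤ ρ ∧ ρ ≤ l ∧ (ρ : ℤ) ≡ r [ZMOD l] := by
  have hl' : (0 : ℤ) < l := by exact_mod_cast hl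
  have h1 := Int.emod_nonneg r hl'.ne'
  have h2 := Int.emod_lt_of_pos r hl'
  have h3 : r % l ≠ 0 := fun h => hr (Int.dvd_of_emod_eq_zero h)
  refine ⟨(r % l).toNat, by omega, by omega, ?_⟩
  rw [Int.toNat_of_nonneg h1]
  exact Int.mod_modEq _ _

lemma norm_rl {l ρ ρ' : ℕ} {r : ℤ} (h1 : 1 ≤ ρ) (h2 : ρ ≤ l) (h3 : (ρ : ℤ) ≡ r [ZMOD l])
    (h1' : 1 ≤ ρ') (h2' : ρ' ≤ l) (h3' : (ρ' : ℤ) ≡ -r [ZMOD l]) (z : ℍ) :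
    ‖rl l r z‖ = Real.exp (π * l * bern (r / l) * z.im + (GG l ρ (qq z)).re
      + (GG l ρ' (qq z)).re) := by
  unfold rl
  rw [class_tprod h1 h2 h3 z.im_pos, class_tprod h1' h2' h3' z.im_pos, norm_mul, norm_mul,
    Complex.norm_exp, Complex.norm_exp, Complex.norm_exp, ← Real.exp_add, ← Real.exp_add]
  congr 3
  have : 2 * (π : ℂ) * Complex.I * (((-(((l : ℤ) : ℝ) * bern ((r : ℝ) / ((l : ℤ) : ℝ)) / 2)) : ℝ) : ℂ)
      * (z : ℂ) = ((-(π * l * bern (r / l)) : ℝ) : ℂ) * (Complex.I * (z : ℂ)) := by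
    push_cast
    ring
  rw [this, Complex.re_ofReal_mul]
  simp

/-- The point `x + i y`. -/
def pt (x y : ℝ) : ℍ := UpperHalfPlane.ofComplex ((x : ℂ) + y * Complex.I)

lemma coe_pt (x : ℝ) {y : ℝ} (hy : 0 < y) : (pt x y : ℂ) = (x : ℂ) + y * Complex.I := by
  have : 0 < ((x : ℂ) + y * Complex.I).im := by simpa using hy
  rw [pt, UpperHalfPlane.ofComplex_apply_of_im_pos this]

lemma im_pt (x : ℝ) {y : ℝ} (hy : 0 < y) : (pt x y).im = y := by
  rw [← UpperHalfPlane.coe_im, coe_pt x hy]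
  simp

lemma norm_rl_pt_le {l : ℕ} {r : ℤ} (hl : 1 ≤ l) (hr : ¬ (l : ℤ) ∣ r) (x : ℝ) {y : ℝ}
    (hy : 0 < y) : ‖rl l r (pt x y)‖ ≤ ‖rl l r (pt 0 y)‖ := by
  obtain ⟨ρ, h1, h2, h3⟩ := exists_rep hr hl
  obtain ⟨ρ', h1', h2', h3'⟩ := exists_rep (r := -r) (by simpa using hr) hl
  rw [norm_rl h1 h2 h3 h1' h2' h3', norm_rl h1 h2 h3 h1' h2' h3', im_pt _ hy, im_pt _ hy]
  have hq : qq (pt 0 y) = ((‖qq (pt x y)‖ : ℝ) : ℂ) := by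
    rw [norm_qq, UpperHalfPlane.coe_im, im_pt _ hy, coe_pt _ hy, qq, Complex.ofReal_exp]
    congr 1
    push_cast
    ring_nf
    simp only [Complex.I_sq]
    ring
  have hlt : ‖qq (pt x y)‖ < 1 := norm_qq_lt (pt x y).im_pos
  have e1 := re_GG_le hl h1 hlt
  have e2 := re_GG_le hl h1' hlt
  rw [← hq] at e1 e2
  apply Real.exp_le_exp.mpr
  linarith

lemma rl_ne_zero {l : ℕ} {r : ℤ} (hl : 1 ≤ l) (hr : ¬ (l : ℤ) ∣ r) (z : ℍ) : rl l r z ≠ 0 := by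
  obtain ⟨ρ, h1, h2, h3⟩ := exists_rep hr hl
  obtain ⟨ρ', h1', h2', h3'⟩ := exists_rep (r := -r) (by simpa using hr) hl
  rw [← norm_pos_iff, norm_rl h1 h2 h3 h1' h2' h3']
  exact Real.exp_pos _

lemma bern_rep {l ρ : ℕ} {r : ℤ} (hl : 1 ≤ l) (h3 : (ρ : ℤ) ≡ r [ZMOD l]) (p : ℤ) :
    bern (ρ * (p / l)) = bern (r * (p / l)) := by
  obtain ⟨s, hs⟩ := h3.dvd
  have hl' : (l : ℝ) ≠ 0 := by
    have : l ≠ 0 := by omega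
    exact_mod_cast this
  have hr : (r : ℝ) = ρ + l * s := by
    have : r = ρ + l * s := by linarith
    rw [this]
    push_cast
    ring
  have : (r : ℝ) * (p / l) = ρ * (p / l) + ((s * p : ℤ) : ℝ) := by
    rw [hr]
    push_cast
    field_simp
  rw [this, bern_add_int]

lemma tendsto_rl {l : ℕ} {r : ℤ} (hl : 1 ≤ l) (hr : ¬ (l : ℤ) ∣ r) (p : ℤ) :
    Tendsto (fun t : ℝ => t * Real.log ‖rl l r (pt (p / l) t)‖) (𝓝[>] 0)
      (𝓝 (π / l * bern (r * (p / l)))) := by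
  obtain ⟨ρ, h1, h2, h3⟩ := exists_rep hr hl
  obtain ⟨ρ', h1', h2', h3'⟩ := exists_rep (r := -r) (by simpa using hr) hl
  have a1 := tendsto_GG hl h1 p
  have a2 := tendsto_GG hl h1' p
  rw [bern_rep hl h3] at a1
  rw [bern_rep hl h3'] at a2
  have e : ((-r : ℤ) : ℝ) * (p / l) = -(r * (p / l)) := by push_cast; ring
  rw [e, bern_neg] at a2
  have a0 : Tendsto (fun t : ℝ => t * (π * l * bern (r / l) * t)) (𝓝[>] 0) (𝓝 0) := by
    have : Continuous (fun t : ℝ => t * (π * l * bern (r / l) * t)) := by fun_prop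
    have h5 := this.tendsto 0
    simp only [mul_zero] at h5
    exact h5.mono_left nhdsWithin_le_nhds
  have a3 := (a0.add a1).add a2
  have hv : 0 + π * bern (r * (p / l)) / (2 * l) + π * bern (r * (p / l)) / (2 * l)
      = π / l * bern (r * (p / l)) := by
    have hl' : (l : ℝ) ≠ 0 := by
      have : l ≠ 0 := by omega
      exact_mod_cast this
    field_simp
    ring
  rw [hv] at a3
  refine a3.congr' ?_
  filter_upwards [self_mem_nhdsWithin] with t ht
  rw [norm_rl h1 h2 h3 h1' h2' h3', Real.log_exp, im_pt _ ht, coe_pt _ ht]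
  ring

/-- Products. -/
lemma tendsto_prod {l k : ℕ} (hl : 1 ≤ l) (r : Fin k → ℤ) (hr : ∀ j, ¬ (l : ℤ) ∣ r j) (p : ℤ) :
    Tendsto (fun t : ℝ => t * Real.log ‖∏ j, rl l (r j) (pt (p / l) t)‖) (𝓝[>] 0)
      (𝓝 (∑ j, π / l * bern (r j * (p / l)))) := by
  have h := tendsto_finsetSum Finset.univ (fun j _ => tendsto_rl hl (hr j) p)
  refine h.congr fun t => ?_
  rw [norm_prod, Real.log_prod, Finset.mul_sum]
  intro j _
  exact norm_ne_zero_iff.mpr (rl_ne_zero hl (hr j) _)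

lemma upper_of_tendsto {F : ℝ → ℝ} {L c : ℝ} (hF : ∀ t, 0 < F t)
    (h : Tendsto (fun t : ℝ => t * Real.log (F t)) (𝓝[>] 0) (𝓝 L)) (hc : L < c) :
    ∀ᶠ t in 𝓝[>] (0 : ℝ), F t ≤ Real.exp (c / t) := by
  filter_upwards [h.eventually_lt_const hc, self_mem_nhdsWithin] with t h1 ht
  have ht' : (0 : ℝ) < t := ht
  rw [← Real.log_le_iff_le_exp (hF t), le_div_iff₀ ht', mul_comm]
  exact h1.le

lemma lower_of_tendsto {F : ℝ → ℝ} {L c : ℝ} (hF : ∀ t, 0 < F t)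
    (h : Tendsto (fun t : ℝ => t * Real.log (F t)) (𝓝[>] 0) (𝓝 L)) (hc : c < L) :
    ∀ᶠ t in 𝓝[>] (0 : ℝ), Real.exp (c / t) ≤ F t := by
  filter_upwards [h.eventually_const_lt hc, self_mem_nhdsWithin] with t h1 ht
  have ht' : (0 : ℝ) < t := ht
  rw [← Real.le_log_iff_exp_le (hF t), div_le_iff₀ ht', mul_comm]
  exact h1.le

/-! ### Simultaneous approximation -/

lemma bern_near {δ : ℝ} (hδ : |δ| < 1 / 7) : 13 / 294 ≤ bern δ := by
  have key : ∀ x : ℝ, 0 ≤ x → x < 1 / 7 → 13 / 294 ≤ bern x := by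
    intro x h0 h1
    have : Int.fract x = x := Int.fract_eq_self.mpr ⟨h0, by linarith⟩
    rw [bern, this]
    nlinarith
  rw [abs_lt] at hδ
  rcases le_total 0 δ with h | h
  · exact key δ h hδ.2
  · rw [← bern_neg]
    exact key (-δ) (by linarith) (by linarith)

lemma dirichlet {l k : ℕ} (hl : 7 ^ k < l) (r : Fin k → ℤ) :
    ∃ p : ℕ, 0 < p ∧ p < l ∧ ∀ j, 13 / 294 ≤ bern (r j * ((p : ℤ) / l)) := by
  have hfl : ∀ x : ℝ, (⌊7 * Int.fract x⌋).toNat < 7 := by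
    intro x
    have h1 : ⌊7 * Int.fract x⌋ < 7 := by
      rw [Int.floor_lt]
      have := Int.fract_lt_one x
      push_cast
      linarith
    omega
  let φ : ℕ → (Fin k → Fin 7) := fun a j => ⟨(⌊7 * Int.fract ((r j : ℝ) * (a / l))⌋).toNat, hfl _⟩
  have hcard : (Finset.univ : Finset (Fin k → Fin 7)).card < (Finset.range l).card := by
    simpa using hl
  obtain ⟨x, hx, y, hy, hxy, he⟩ := Finset.exists_ne_map_eq_of_card_lt_of_maps_to hcard
    (f := φ) (fun _ _ => by simp)
  have main : ∀ x y : ℕ, φ x = φ y → x < y → y < l →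
      ∃ p : ℕ, 0 < p ∧ p < l ∧ ∀ j, 13 / 294 ≤ bern (r j * ((p : ℤ) / l)) := by
    intro x y he hlt hyl
    refine ⟨y - x, by omega, by omega, fun j => ?_⟩
    have h1 := congrArg Fin.val (congrFun he j)
    simp only [φ] at h1
    set X : ℝ := (r j : ℝ) * (x / l) with hX
    set Y : ℝ := (r j : ℝ) * (y / l) with hY
    have p1 : 0 ≤ ⌊7 * Int.fract X⌋ := Int.floor_nonneg.mpr (by have := Int.fract_nonneg X; linarith)
    have p2 : 0 ≤ ⌊7 * Int.fract Y⌋ := Int.floor_nonneg.mpr (by have := Int.fract_nonneg Y; linarith)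
    have h2 : ⌊7 * Int.fract Y⌋ = ⌊7 * Int.fract X⌋ := by omega
    have h3 := Int.abs_sub_lt_one_of_floor_eq_floor h2
    have h4 : |Int.fract Y - Int.fract X| < 1 / 7 := by
      rw [abs_lt] at h3 ⊢
      constructor <;> linarith [h3.1, h3.2]
    have h5 : (r j : ℝ) * (((y - x : ℕ) : ℤ) / l)
        = (Int.fract Y - Int.fract X) + ((⌊Y⌋ - ⌊X⌋ : ℤ) : ℝ) := by
      have e1 := Int.fract_add_floor X
      have e2 := Int.fract_add_floor Y
      have e3 : (r j : ℝ) * (((y - x : ℕ) : ℤ) / l) = Y - X := by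
        rw [hX, hY]
        push_cast [Nat.cast_sub hlt.le]
        ring
      rw [e3]
      push_cast
      linarith
    rw [h5, bern_add_int]
    exact bern_near h4
  simp only [Finset.mem_range] at hx hy
  rcases lt_or_gt_of_ne hxy with h | h
  · exact main x y he h hy
  · exact main y x he.symm h hx

lemma exists_moeb (a d u v : ℤ) (h : u * a + v * d = 1) (hd : 0 < d) :
    ∃ M : SL(2, ℤ), ∀ Y : ℝ, 0 < Y → M • pt (-u / d) Y = pt (a / d) (1 / ((d : ℝ) ^ 2 * Y)) := by
  obtain ⟨M, m1, m2, m3, m4⟩ : ∃ M : SL(2, ℤ), M.1 0 0 = a ∧ M.1 0 1 = -v ∧ M.1 1 0 = d ∧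
      M.1 1 1 = u :=
    ⟨⟨!![a, -v; d, u], by rw [Matrix.det_fin_two_of]; linarith⟩, rfl, rfl, rfl, rfl⟩
  refine ⟨M, fun Y hY => ?_⟩
  have hd' : (0 : ℝ) < d := by exact_mod_cast hd
  have hdc : (d : ℂ) ≠ 0 := by exact_mod_cast hd.ne'
  have hYc : (Y : ℂ) ≠ 0 := by exact_mod_cast hY.ne'
  have hc : (u : ℂ) * a + v * d = 1 := by exact_mod_cast h
  apply UpperHalfPlane.ext
  rw [UpperHalfPlane.coe_specialLinearGroup_apply, coe_pt _ hY, coe_pt _ (by positivity),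
    m1, m2, m3, m4]
  simp
  have e : (d : ℂ) * (-u / d + Y * Complex.I) + u = d * Y * Complex.I := by
    field_simp
    ring
  rw [e]
  field_simp
  ring_nf
  simp only [Complex.I_sq]
  linear_combination (-1 : ℂ) * hc

/-! ### Growth in the span -/

lemma span_isBigO {S : Set (ℍ → ℂ)} {g : ℝ → ℍ} {E : ℝ → ℝ}
    (h : ∀ f ∈ S, (fun Y => f (g Y)) =O[atTop] E) {f : ℍ → ℂ} (hf : f ∈ Submodule.span ℂ S) :
    (fun Y => f (g Y)) =O[atTop] E := by
  induction hf using Submodule.span_induction with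
  | mem x hx => exact h x hx
  | zero => exact Asymptotics.isBigO_zero _ _
  | add x y _ _ hx hy => exact hx.add hy
  | smul a x _ hx => exact hx.const_mul_left a

theorem core {n l : ℕ} (hl : 1 ≤ l) {S : Set (ℍ → ℂ)} (hS : S ⊆ Enl n l) (hM : IsModularSet S)
    (hnt : ∃ f ∈ S, f ≠ fun _ => 1) : l ≤ 7 ^ n := by
  by_contra hlt
  push Not at hlt
  obtain ⟨hfin, hne, hinv⟩ := hM
  have hrep : ∀ f : S, ∃ k : ℕ, k ≤ n ∧ ∃ r : Fin k → ℤ, (∀ j, ¬ (l : ℤ) ∣ r j) ∧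
    (f : ℍ → ℂ) = fun z => ∏ j, rl l (r j) z := fun f => hS f.2
  choose k hk r hr hf using hrep
  have : Finite S := hfin
  have : Nonempty S := hne.to_subtype
  obtain ⟨f₀, hf₀⟩ := Finite.exists_max k
  have hl' : (0 : ℝ) < l := by exact_mod_cast hl
  have hπ := Real.pi_pos
  have hkpos : 0 < k f₀ := by
    obtain ⟨f, hfS, hf1⟩ := hnt
    by_contra h0
    have h1 : k ⟨f, hfS⟩ = 0 := by have := hf₀ ⟨f, hfS⟩; omega
    apply hf1
    have h2 := hf ⟨f, hfS⟩
    simp only at h2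
    rw [h2]
    funext z
    apply Finset.prod_eq_one
    intro j
    exact absurd j.2 (by omega)
  have hkpos' : (0 : ℝ) < k f₀ := by exact_mod_cast hkpos
  -- the approximation
  obtain ⟨p, hp0, hpl, hp⟩ := dirichlet
    (lt_of_le_of_lt (Nat.pow_le_pow_right (by norm_num) (hk f₀)) hlt) (r f₀)
  obtain ⟨a, d, hco, hpa, hld⟩ := Nat.exists_coprime p l
  set g := Nat.gcd p l
  have hd2 : 2 ≤ d := by
    by_contra hd
    have : d = 0 ∨ d = 1 := by omega
    rcases this with rfl | rfl
    · omega
    · have : a = 0 ∨ 1 ≤ a := by omega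
      rcases this with rfl | h
      · omega
      · nlinarith
  have hd2' : (2 : ℝ) ≤ d := by exact_mod_cast hd2
  have hdpos : (0 : ℝ) < d := by linarith
  have hratio : (((p : ℤ) : ℝ) / l) = ((a : ℤ) : ℝ) / ((d : ℤ) : ℝ) := by
    rw [div_eq_div_iff hl'.ne' (by exact_mod_cast hdpos.ne')]
    have : p * d = a * l := by
      rw [hld]
      conv_lhs => rw [hpa]
      ring
    exact_mod_cast this
  obtain ⟨u, v, huv⟩ := Nat.isCoprime_iff_coprime.mpr hco
  obtain ⟨M, hMoeb⟩ := exists_moeb a d u v huv (by omega)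
  obtain ⟨W, hW⟩ := exists_moeb 0 1 0 1 (by norm_num) (by norm_num)
  -- constants
  set β : ℝ := π / l * (k f₀ / 6) with hβ
  set Λ : ℝ := ∑ j, π / l * bern (r f₀ j * ((p : ℤ) / l)) with hΛ
  have hΛ' : π / l * (k f₀ * (13 / 294)) ≤ Λ := by
    have h1 : ∑ _j : Fin (k f₀), π / l * (13 / 294 : ℝ) ≤ Λ := by
      apply Finset.sum_le_sum
      intro j _
      have := hp j
      have : 0 ≤ π / l := by positivity
      gcongr
    simp only [Finset.sum_const, Finset.card_univ, Fintype.card_fin, nsmul_eq_mul] at h1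
    linarith
  have hgap : β < (d : ℝ) ^ 2 * Λ := by
    have hc : 0 < π / l * k f₀ := by positivity
    have hd4 : (4 : ℝ) ≤ (d : ℝ) ^ 2 := by nlinarith
    have : 0 < Λ := lt_of_lt_of_le (by positivity) hΛ'
    nlinarith
  obtain ⟨β₁, hb1, hb1'⟩ := exists_between hgap
  obtain ⟨β₂, hb2, hb2'⟩ := exists_between hb1'
  have hpos : ∀ (f : S) (z : ℍ), 0 < ‖(f : ℍ → ℂ) z‖ := by
    intro f z
    rw [hf f, norm_pos_iff]
    exact Finset.prod_ne_zero_iff.mpr fun j _ => rl_ne_zero hl (hr f j) z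
  have hinvt : Tendsto (fun Y : ℝ => 1 / Y) atTop (𝓝[>] 0) := by
    simpa using tendsto_inv_atTop_nhdsGT_zero (𝕜 := ℝ)
  -- step 1
  have s1 : ∀ f ∈ S, (fun Y : ℝ => f (pt 0 (1 / Y))) =O[atTop] fun Y => Real.exp (β₁ * Y) := by
    intro f hfS
    have h1 := tendsto_prod hl (r ⟨f, hfS⟩) (hr ⟨f, hfS⟩) 0
    have h2 : ∑ j, π / l * bern (r ⟨f, hfS⟩ j * ((0 : ℤ) / l)) < β₁ := by
      refine lt_of_le_of_lt ?_ hb1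
      have hb0 : bern 0 = 1 / 6 := by simp [bern]
      have hkk : (k ⟨f, hfS⟩ : ℝ) ≤ k f₀ := by exact_mod_cast hf₀ _
      have : 0 ≤ π / l := by positivity
      simp only [Int.cast_zero, zero_div, mul_zero, hb0, Finset.sum_const, Finset.card_univ,
        Fintype.card_fin, nsmul_eq_mul]
      rw [hβ]
      nlinarith
    have h3 := upper_of_tendsto (F := fun t => ‖∏ j, rl l (r ⟨f, hfS⟩ j) (pt ((0 : ℤ) / l) t)‖)
      (fun t => norm_pos_iff.mpr (Finset.prod_ne_zero_iff.mpr
        fun j _ => rl_ne_zero hl (hr ⟨f, hfS⟩ j) _)) h1 h2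
    refine Asymptotics.IsBigO.of_bound 1 ?_
    filter_upwards [hinvt.eventually h3] with Y hY
    have e := hf ⟨f, hfS⟩
    simp only at e
    rw [e, one_mul, Real.norm_of_nonneg (Real.exp_pos _).le]
    simpa using hY
  -- step 2
  have s2 : ∀ f ∈ S, (fun Y : ℝ => f (pt 0 Y)) =O[atTop] fun Y => Real.exp (β₁ * Y) := by
    intro f hfS
    have h1 := span_isBigO s1 (hinv W f (Submodule.subset_span hfS))
    refine h1.congr' ?_ EventuallyEq.rfl
    filter_upwards [eventually_gt_atTop 0] with Y hY
    have h2 := hW (1 / Y) (by positivity)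
    simp only [Int.cast_zero, Int.cast_one, neg_zero, zero_div, one_pow, one_mul, one_div_one_div]
      at h2
    rw [h2]
  -- step 3
  have s3 : ∀ f ∈ S, (fun Y : ℝ => f (pt (-u / (d : ℤ)) Y)) =O[atTop]
      fun Y => Real.exp (β₁ * Y) := by
    intro f hfS
    refine Asymptotics.IsBigO.trans ?_ (s2 f hfS)
    refine Asymptotics.IsBigO.of_bound 1 ?_
    filter_upwards [eventually_gt_atTop 0] with Y hY
    have e := hf ⟨f, hfS⟩
    simp only at e
    rw [e, one_mul, norm_prod, norm_prod]
    exact Finset.prod_le_prod (fun _ _ => norm_nonneg _)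
      fun j _ => norm_rl_pt_le hl (hr ⟨f, hfS⟩ j) _ hY
  -- step 4
  have s4 := span_isBigO s3 (hinv M f₀ (Submodule.subset_span f₀.2))
  have low := lower_of_tendsto
    (F := fun t => ‖∏ j, rl l (r f₀ j) (pt ((p : ℤ) / l) t)‖) (c := β₂ / (d : ℝ) ^ 2)
      (fun t => norm_pos_iff.mpr (Finset.prod_ne_zero_iff.mpr
        fun j _ => rl_ne_zero hl (hr f₀ j) _)) (tendsto_prod hl (r f₀) (hr f₀) p)
      (by rw [div_lt_iff₀ (by positivity)]; linarith)
  have ht2 : Tendsto (fun Y : ℝ => 1 / ((d : ℝ) ^ 2 * Y)) atTop (𝓝[>] 0) :=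
    hinvt.comp (tendsto_id.const_mul_atTop (by positivity))
  have s5 : (fun Y : ℝ => Real.exp (β₂ * Y)) =O[atTop] fun Y => Real.exp (β₁ * Y) := by
    refine Asymptotics.IsBigO.trans ?_ s4
    refine Asymptotics.IsBigO.of_bound 1 ?_
    filter_upwards [eventually_gt_atTop 0, ht2.eventually low] with Y hY h1
    rw [one_mul, Real.norm_of_nonneg (Real.exp_pos _).le, hMoeb Y hY, hf f₀, ← hratio]
    have e : β₂ / (d : ℝ) ^ 2 / (1 / ((d : ℝ) ^ 2 * Y)) = β₂ * Y := by
      field_simp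
    rw [e] at h1
    exact h1
  obtain ⟨C, hC⟩ := s5.bound
  have s6 : Tendsto (fun Y : ℝ => Real.exp ((β₂ - β₁) * Y)) atTop atTop :=
    Real.tendsto_exp_atTop.comp (tendsto_id.const_mul_atTop (by linarith))
  obtain ⟨Y, h1, h2⟩ := (hC.and (s6.eventually_gt_atTop C)).exists
  rw [Real.norm_of_nonneg (Real.exp_pos _).le, Real.norm_of_nonneg (Real.exp_pos _).le] at h1
  have e : Real.exp (β₂ * Y) = Real.exp ((β₂ - β₁) * Y) * Real.exp (β₁ * Y) := by
    rw [← Real.exp_add]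
    congr 1
    ring
  rw [e] at h1
  have := le_of_mul_le_mul_right h1 (Real.exp_pos _)
  linarith

/-- Theorem 2: if `E_n(l)` contains a nontrivial modular set then `l ≤ 13.7^n`; in particular,
for each `n` there are only finitely many such `l`. -/
theorem sl2z_invariant_units_stmt4 (n : ℕ) (hn : 1 ≤ n) :
    (∀ l : ℕ, 1 ≤ l →
      (∃ S : Set (UpperHalfPlane → ℂ),
        S ⊆ Enl n l ∧ IsModularSet S ∧ ∃ f ∈ S, f ≠ fun _ => 1) →
      (l : ℝ) ≤ (13.7 : ℝ) ^ n) ∧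
    {l : ℕ | 1 ≤ l ∧ ∃ S : Set (UpperHalfPlane → ℂ),
        S ⊆ Enl n l ∧ IsModularSet S ∧ ∃ f ∈ S, f ≠ fun _ => 1}.Finite := by
  have main : ∀ l : ℕ, 1 ≤ l →
      (∃ S : Set (UpperHalfPlane → ℂ),
        S ⊆ Enl n l ∧ IsModularSet S ∧ ∃ f ∈ S, f ≠ fun _ => 1) →
      l ≤ 7 ^ n := by
    rintro l hl ⟨S, hS, hM, hnt⟩
    exact core hl hS hM hnt
  refine ⟨fun l hl h => ?_, (Set.finite_Iic (7 ^ n)).subset fun l hl => main l hl.1 hl.2⟩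
  have h1 : (l : ℝ) ≤ (7 : ℝ) ^ n := by exact_mod_cast main l hl h
  exact h1.trans (pow_le_pow_left₀ (by norm_num) (by norm_num) n)
end
end

section
/- Let l ≥ 1 and r be integers with l ∤ r, and let A = (a b; c d) ∈ SL(2,ℤ). Set t = gcd(c,l). Then there is a nonzero complex constant κ such that [r]_l(Az)·exp(2πi·(t²/(2l))·B(ar/t)·z) → κ as z = iy with real y → ∞. Equivalently, the order of [r]_l at the cusp s = a/c is ord_s([r]_l) = −(t²/(2l))·B(ar/t). -/
open Complex Filter Topology UpperHalfPlane Matrix MatrixGroups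
open scoped Real Manifold

noncomputable section

/-- The point `i·max t 1` on the imaginary axis of the upper half plane (equal to `it` for
`t ≥ 1`). -/
def iPt (t : ℝ) : UpperHalfPlane :=
  ⟨⟨0, max t 1⟩, lt_of_lt_of_le one_pos (le_max_right t 1)⟩


-- The Jacobi triple product

def poch (Q : ℂ) (m : ℕ) : ℂ := ∏ k ∈ Finset.range m, (1 - Q ^ (k + 1))

def eP (Q : ℂ) (m : ℤ) : ℂ := if m < 0 then 0 else (poch Q m.toNat)⁻¹

lemma one_sub_pow_ne {Q : ℂ} (hQ : ‖Q‖ < 1) (k : ℕ) : 1 - Q ^ (k + 1) ≠ 0 := by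
  intro h
  have h1 : Q ^ (k + 1) = 1 := (sub_eq_zero.mp h).symm
  have h2 : ‖Q‖ ^ (k + 1) < 1 := pow_lt_one₀ (norm_nonneg _) hQ (by omega)
  rw [← norm_pow, h1, norm_one] at h2
  exact lt_irrefl _ h2

lemma poch_ne {Q : ℂ} (hQ : ‖Q‖ < 1) (m : ℕ) : poch Q m ≠ 0 :=
  Finset.prod_ne_zero_iff.mpr fun k _ => one_sub_pow_ne hQ k

lemma eP_rec {Q : ℂ} (hQ : ‖Q‖ < 1) (m : ℤ) : eP Q (m - 1) = (1 - Q ^ m) * eP Q m := by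
  rcases lt_trichotomy m 0 with h | h | h
  · simp [eP, h, show m - 1 < 0 by omega]
  · subst h; simp [eP]
  · obtain ⟨k, rfl⟩ : ∃ k : ℕ, m = k + 1 := ⟨(m - 1).toNat, by omega⟩
    have h1 : ¬ ((k : ℤ) + 1 < 0) := by omega
    have h2 : ((k : ℤ) + 1).toNat = k + 1 := by omega
    have h3 : ¬ ((k : ℤ) < 0) := by omega
    have e : Q ^ ((k : ℤ) + 1) = Q ^ (k + 1) := by exact_mod_cast zpow_natCast Q (k + 1)
    simp only [eP, add_sub_cancel_right, h1, h3, if_false, h2, e, Int.toNat_natCast]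
    rw [poch, poch, Finset.prod_range_succ, mul_inv, mul_comm _ (1 - Q ^ (k + 1))⁻¹, ← mul_assoc,
      mul_inv_cancel₀ (one_sub_pow_ne hQ k), one_mul]

lemma finite_jtp {p x : ℂ} (hp : p ≠ 0) (hp1 : ‖p ^ 2‖ < 1) (hx : x ≠ 0) (N : ℕ) :
    HasSum (fun n : ℤ => p ^ (n ^ 2) * x ^ n *
      (poch (p ^ 2) (2 * N) * eP (p ^ 2) (N + n) * eP (p ^ 2) (N - n)))
      (∏ k ∈ Finset.range N, ((1 + x * p ^ (2 * k + 1)) * (1 + x⁻¹ * p ^ (2 * k + 1)))) := by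
  induction N with
  | zero =>
    have := hasSum_single (f := fun n : ℤ => p ^ (n ^ 2) * x ^ n *
      (poch (p ^ 2) (2 * 0) * eP (p ^ 2) ((0 : ℕ) + n) * eP (p ^ 2) ((0 : ℕ) - n))) 0 ?_
    · simpa [poch, eP] using this
    · intro n hn
      rcases lt_or_gt_of_ne hn with h | h
      · simp [eP, h]
      · simp [eP, h]
  | succ N ih =>
    rw [Finset.prod_range_succ]
    have h0 := ih.mul_left (1 + p ^ (4 * N + 2))
    have h1 := ((Equiv.addRight (-1 : ℤ)).hasSum_iff.mpr ih).mul_left (x * p ^ (2 * N + 1))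
    have h2 := ((Equiv.addRight (1 : ℤ)).hasSum_iff.mpr ih).mul_left (x⁻¹ * p ^ (2 * N + 1))
    have h := (h0.add h1).add h2
    convert! h using 1
    · funext n
      simp only [Function.comp, Equiv.coe_addRight]
      set Q := p ^ 2 with hQ
      have hQ0 : Q ≠ 0 := pow_ne_zero 2 hp
      have ea : eP Q (N + n) = (1 - Q ^ ((N : ℤ) + n + 1)) * eP Q (N + n + 1) := by
        rw [← eP_rec hp1]; congr 1; ring
      have ea' : eP Q (N + (n + -1)) = (1 - Q ^ ((N : ℤ) + n)) * eP Q (N + n) := by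
        rw [← eP_rec hp1]; congr 1; ring
      have eb : eP Q (N - n) = (1 - Q ^ ((N : ℤ) - n + 1)) * eP Q (N - n + 1) := by
        rw [← eP_rec hp1]; congr 1; ring
      have eb' : eP Q (N - (n + 1)) = (1 - Q ^ ((N : ℤ) - n)) * eP Q (N - n) := by
        rw [← eP_rec hp1]; congr 1; ring
      have ec : eP Q (N - (n + -1)) = eP Q (N - n + 1) := by congr 1; ring
      have ed : eP Q (N + (n + 1)) = eP Q (N + n + 1) := by congr 1; ring
      have ee : eP Q (((N + 1 : ℕ) : ℤ) + n) = eP Q (N + n + 1) := by congr 1; push_cast; ring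
      have ef : eP Q (((N + 1 : ℕ) : ℤ) - n) = eP Q (N - n + 1) := by congr 1; push_cast; ring
      have eg : poch Q (2 * (N + 1)) = poch Q (2 * N) * (1 - Q ^ (2 * N + 1)) *
          (1 - Q ^ (2 * N + 2)) := by
        rw [poch, show 2 * (N + 1) = 2 * N + 1 + 1 by ring, Finset.prod_range_succ,
          Finset.prod_range_succ, ← poch]
      rw [ea', eb', ec, ed, ee, ef, ea, eb, eg]
      set X := Q ^ ((N : ℤ) + n) with hX
      set Y := Q ^ ((N : ℤ) - n) with hY
      have eX : Q ^ ((N : ℤ) + n + 1) = X * Q := zpow_add_one₀ hQ0 _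
      have eY : Q ^ ((N : ℤ) - n + 1) = Y * Q := zpow_add_one₀ hQ0 _
      have eXY : Q ^ (2 * N) = X * Y := by
        rw [hX, hY, ← zpow_add₀ hQ0, ← zpow_natCast]; congr 1; push_cast; ring
      have e1 : Q ^ (2 * N + 1) = X * Y * Q := by rw [pow_succ, eXY]
      have e2 : Q ^ (2 * N + 2) = X * Y * Q * Q := by rw [pow_succ, e1]
      have e3 : p ^ (4 * N + 2) = X * Y * Q := by
        rw [← e1, hQ, ← pow_mul]; congr 1; ring
      have e4 : x * p ^ (2 * N + 1) * (p ^ ((n + -1) ^ 2) * x ^ (n + -1)) =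
          p ^ (n ^ 2) * x ^ n * (Y * Q) := by
        rw [← eY, hQ, ← zpow_natCast, ← zpow_natCast p 2, ← _root_.zpow_mul, zpow_add₀ hx, _root_.zpow_neg_one]
        have : p ^ ((2 * N + 1 : ℕ) : ℤ) * p ^ ((n + -1) ^ 2) =
            p ^ (n ^ 2) * p ^ (((2 : ℕ) : ℤ) * (N - n + 1)) := by
          rw [← zpow_add₀ hp, ← zpow_add₀ hp]; congr 1; push_cast; ring
        field_simp
        linear_combination this
      have e5 : x⁻¹ * p ^ (2 * N + 1) * (p ^ ((n + 1) ^ 2) * x ^ (n + 1)) =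
          p ^ (n ^ 2) * x ^ n * (X * Q) := by
        rw [← eX, hQ, ← zpow_natCast, ← zpow_natCast p 2, ← _root_.zpow_mul, zpow_add₀ hx, zpow_one]
        have : p ^ ((2 * N + 1 : ℕ) : ℤ) * p ^ ((n + 1) ^ 2) =
            p ^ (n ^ 2) * p ^ (((2 : ℕ) : ℤ) * (N + n + 1)) := by
          rw [← zpow_add₀ hp, ← zpow_add₀ hp]; congr 1; push_cast; ring
        field_simp
        linear_combination this
      rw [← mul_assoc (x * p ^ (2 * N + 1)), ← mul_assoc (x⁻¹ * p ^ (2 * N + 1)), e4, e5,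
        eX, eY, e1, e2, e3]
      ring
    · have : x * x⁻¹ = 1 := mul_inv_cancel₀ hx
      generalize (∏ k ∈ Finset.range N, ((1 + x * p ^ (2 * k + 1)) * (1 + x⁻¹ * p ^ (2 * k + 1)))) = P
      linear_combination (P * p ^ (4 * N + 2)) * this

lemma poch_tendsto {Q : ℂ} (hQ : ‖Q‖ < 1) :
    Tendsto (poch Q) atTop (𝓝 (∏' k : ℕ, (1 - Q ^ (k + 1)))) :=
  (ModularForm.multipliable_one_sub_pow hQ).tendsto_prod_tprod_nat

lemma poch_inf_ne {Q : ℂ} (hQ : ‖Q‖ < 1) : (∏' k : ℕ, (1 - Q ^ (k + 1))) ≠ 0 := by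
  simp_rw [sub_eq_add_neg]
  refine tprod_one_add_ne_zero_of_summable (f := fun n => -Q ^ (n + 1)) ?_ ?_
  · intro i; simpa [sub_eq_add_neg] using one_sub_pow_ne hQ i
  · simpa using (summable_nat_add_iff 1).mpr (summable_geometric_of_lt_one (norm_nonneg _) hQ)

lemma mult_factor {p : ℂ} (hp1 : ‖p‖ < 1) (x : ℂ) :
    Summable fun k : ℕ => ‖x * p ^ (2 * k + 1)‖ := by
  have h2 : ‖p‖ ^ 2 < 1 := pow_lt_one₀ (norm_nonneg _) hp1 (by norm_num)
  have := (summable_geometric_of_lt_one (by positivity) h2).mul_left (‖x‖ * ‖p‖)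
  refine this.congr fun k => ?_
  rw [norm_mul, norm_pow, pow_succ _ (2 * k), pow_mul]; ring

lemma jtp (z τ : ℂ) (hτ : 0 < τ.im) :
    jacobiTheta₂ z τ = (∏' k : ℕ, (1 - cexp (2 * π * Complex.I * τ) ^ (k + 1))) *
      ((∏' k : ℕ, (1 + cexp (2 * π * Complex.I * z) * cexp (π * Complex.I * τ) ^ (2 * k + 1))) *
      (∏' k : ℕ, (1 + (cexp (2 * π * Complex.I * z))⁻¹ * cexp (π * Complex.I * τ) ^ (2 * k + 1)))) := by
  set p := cexp (π * Complex.I * τ) with hp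
  set x := cexp (2 * π * Complex.I * z) with hx
  have hQ : cexp (2 * π * Complex.I * τ) = p ^ 2 := by rw [hp, ← Complex.exp_nat_mul]; congr 1; push_cast; ring
  rw [hQ]
  have hp0 : p ≠ 0 := Complex.exp_ne_zero _
  have hx0 : x ≠ 0 := Complex.exp_ne_zero _
  have hp1 : ‖p‖ < 1 := by
    rw [hp, Complex.norm_exp, Real.exp_lt_one_iff]
    simp
    positivity
  have hQ1 : ‖p ^ 2‖ < 1 := by rw [norm_pow]; exact pow_lt_one₀ (norm_nonneg _) hp1 (by norm_num)
  have hterm : ∀ n : ℤ, p ^ (n ^ 2) * x ^ n = jacobiTheta₂_term n z τ := by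
    intro n
    rw [jacobiTheta₂_term, hp, hx, ← Complex.exp_int_mul, ← Complex.exp_int_mul, ← Complex.exp_add]
    congr 1; push_cast; ring
  set E := ∏' k : ℕ, (1 - (p ^ 2) ^ (k + 1)) with hE
  have hE0 : E ≠ 0 := poch_inf_ne hQ1
  have hpt := poch_tendsto hQ1
  rw [← hE] at hpt
  have hpi : Tendsto (fun m => (poch (p ^ 2) m)⁻¹) atTop (𝓝 E⁻¹) := hpt.inv₀ hE0
  obtain ⟨C1, hC1⟩ := (Metric.isBounded_range_of_tendsto _ hpt).exists_norm_le
  obtain ⟨C2, hC2⟩ := (Metric.isBounded_range_of_tendsto _ hpi).exists_norm_le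
  have b1 : ∀ m, ‖poch (p ^ 2) m‖ ≤ C1 := fun m => hC1 _ ⟨m, rfl⟩
  have hC20 : 0 ≤ C2 := (norm_nonneg _).trans (hC2 _ ⟨0, rfl⟩)
  have hC10 : 0 ≤ C1 := (norm_nonneg _).trans (hC1 _ ⟨0, rfl⟩)
  have b2 : ∀ m, ‖eP (p ^ 2) m‖ ≤ C2 := by
    intro m
    rw [eP]; split_ifs
    · simpa using hC20
    · exact hC2 _ ⟨_, rfl⟩
  have heP : ∀ f : ℕ → ℤ, Tendsto f atTop atTop →
      Tendsto (fun N => eP (p ^ 2) (f N)) atTop (𝓝 E⁻¹) := by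
    intro f hf
    have h1 : Tendsto (fun N => (f N).toNat) atTop atTop :=
      tendsto_atTop.mpr fun b => (tendsto_atTop.mp hf (b : ℤ)).mono fun N hN => by omega
    refine (hpi.comp h1).congr' ?_
    filter_upwards [tendsto_atTop.mp hf 0] with N hN
    simp [eP, not_lt.mpr hN]
  have key := tendsto_tsum_of_dominated_convergence (𝓕 := atTop)
    (f := fun (N : ℕ) (n : ℤ) => p ^ (n ^ 2) * x ^ n *
      (poch (p ^ 2) (2 * N) * eP (p ^ 2) (N + n) * eP (p ^ 2) (N - n)))
    (g := fun n => p ^ (n ^ 2) * x ^ n * (E * E⁻¹ * E⁻¹))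
    (bound := fun n => ‖jacobiTheta₂_term n z τ‖ * (C1 * C2 * C2))
    (((summable_jacobiTheta₂_term_iff z τ).mpr hτ).norm.mul_right _) ?_ ?_
  · have hN : Tendsto (fun N => ∏ k ∈ Finset.range N,
        ((1 + x * p ^ (2 * k + 1)) * (1 + x⁻¹ * p ^ (2 * k + 1)))) atTop
        (𝓝 ((∏' k : ℕ, (1 + x * p ^ (2 * k + 1))) * (∏' k : ℕ, (1 + x⁻¹ * p ^ (2 * k + 1))))) := by
      simp_rw [Finset.prod_mul_distrib]
      exact (multipliable_one_add_of_summable (mult_factor hp1 x)).tendsto_prod_tprod_nat.mul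
        (multipliable_one_add_of_summable (mult_factor hp1 x⁻¹)).tendsto_prod_tprod_nat
    have := tendsto_nhds_unique hN (key.congr fun N => (finite_jtp hp0 hQ1 hx0 N).tsum_eq)
    rw [this, tsum_mul_right, mul_inv_cancel₀ hE0, one_mul, jacobiTheta₂, mul_comm, mul_assoc,
      inv_mul_cancel₀ hE0, mul_one]
    simp_rw [hterm]
  · intro n
    have t2 : Tendsto (fun N : ℕ => 2 * N) atTop atTop :=
      tendsto_atTop.mpr fun b => (eventually_ge_atTop b).mono fun N hN => by omega
    refine Tendsto.const_mul _ (((hpt.comp t2).mul (heP _ ?_)).mul (heP _ ?_))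
    · exact tendsto_atTop.mpr fun b =>
        (eventually_ge_atTop (b - n).toNat).mono fun N hN => by omega
    · exact tendsto_atTop.mpr fun b =>
        (eventually_ge_atTop (b + n).toNat).mono fun N hN => by omega
  · refine Eventually.of_forall fun N n => ?_
    rw [hterm, norm_mul, norm_mul, norm_mul]
    gcongr
    exacts [b1 _, b2 _, b2 _]

-- Siegel-type functions via theta functions

def HH (v w : ℝ) (τ : ℂ) : ℂ :=
  cexp (π * Complex.I * ((v : ℂ) - 1 / 2) ^ 2 * τ) *
    jacobiTheta₂ (((v : ℂ) - 1 / 2) * τ + ((w : ℂ) - 1 / 2)) τ / ModularForm.eta τ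

lemma HH_add_one_left (v w : ℝ) (τ : ℂ) :
    HH (v + 1) w τ = cexp (-2 * π * Complex.I * ((w : ℂ) - 1 / 2)) * HH v w τ := by
  rw [HH, HH]
  rw [show (((v + 1 : ℝ) : ℂ) - 1 / 2) * τ + ((w : ℂ) - 1 / 2) =
    (((v : ℂ) - 1 / 2) * τ + ((w : ℂ) - 1 / 2)) + τ by push_cast; ring, jacobiTheta₂_add_left',
    ← mul_assoc, ← mul_div_assoc, ← mul_assoc, ← Complex.exp_add, ← Complex.exp_add]
  congr 3
  push_cast; ring

lemma HH_add_one_right (v w : ℝ) (τ : ℂ) : HH v (w + 1) τ = HH v w τ := by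
  rw [HH, HH]
  rw [show ((v : ℂ) - 1 / 2) * τ + (((w + 1 : ℝ) : ℂ) - 1 / 2) =
    (((v : ℂ) - 1 / 2) * τ + ((w : ℂ) - 1 / 2)) + 1 by push_cast; ring, jacobiTheta₂_add_left]

lemma HH_add_int_right (v w : ℝ) (n : ℤ) (τ : ℂ) : HH v (w + n) τ = HH v w τ := by
  induction n using Int.induction_on with
  | zero => simp
  | succ n ih => rw [← ih, ← HH_add_one_right v (w + ((n : ℤ) : ℝ))]; congr 1; push_cast; ring
  | pred n ih => rw [← ih, ← HH_add_one_right]; congr 1; push_cast; ring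

lemma HH_add_int_left (v w : ℝ) (n : ℤ) :
    ∃ c : ℂ, c ≠ 0 ∧ ∀ τ : ℂ, HH (v + n) w τ = c * HH v w τ := by
  induction n using Int.induction_on with
  | zero => exact ⟨1, one_ne_zero, by simp⟩
  | succ n ih =>
    obtain ⟨c, hc, h⟩ := ih
    refine ⟨cexp (-2 * π * Complex.I * ((w : ℂ) - 1 / 2)) * c,
      mul_ne_zero (Complex.exp_ne_zero _) hc, fun τ => ?_⟩
    rw [mul_assoc, ← h, ← HH_add_one_left]; congr 1; push_cast; ring
  | pred n ih =>
    obtain ⟨c, hc, h⟩ := ih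
    refine ⟨(cexp (-2 * π * Complex.I * ((w : ℂ) - 1 / 2)))⁻¹ * c,
      mul_ne_zero (inv_ne_zero (Complex.exp_ne_zero _)) hc, fun τ => ?_⟩
    rw [mul_assoc, ← h, eq_inv_mul_iff_mul_eq₀ (Complex.exp_ne_zero _), ← HH_add_one_left]
    congr 1; push_cast; ring

lemma theta_T (z τ : ℂ) : jacobiTheta₂ z (τ + 1) = jacobiTheta₂ (z + 1 / 2) τ := by
  refine tsum_congr fun n => ?_
  rw [jacobiTheta₂_term, jacobiTheta₂_term, Complex.exp_eq_exp_iff_exists_int]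
  obtain ⟨k, hk⟩ := Int.even_mul_succ_self (n - 1)
  refine ⟨k, ?_⟩
  have : (n : ℂ) ^ 2 - n = 2 * k := by
    have : n ^ 2 - n = 2 * k := by linarith [hk]
    exact_mod_cast this
  linear_combination (π * Complex.I) * this

lemma eta_T (τ : ℂ) : ModularForm.eta (τ + 1) = cexp (2 * π * Complex.I / 24) * ModularForm.eta τ := by
  rw [ModularForm.eta, ModularForm.eta]
  have h1 : ∀ n, ModularForm.eta_q n (τ + 1) = ModularForm.eta_q n τ := by
    intro n
    rw [ModularForm.eta_q_eq_pow, ModularForm.eta_q_eq_pow, mul_add, mul_one, Complex.exp_add,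
      Complex.exp_two_pi_mul_I, mul_one]
  simp_rw [h1, Function.Periodic.qParam]
  rw [← mul_assoc, ← Complex.exp_add]
  congr 2
  push_cast; ring

lemma HH_T (v w : ℝ) : ∃ c : ℂ, c ≠ 0 ∧ ∀ τ : ℂ, HH v w (τ + 1) = c * HH v (v + w) τ := by
  refine ⟨cexp (π * Complex.I * ((v : ℂ) - 1 / 2) ^ 2) / cexp (2 * π * Complex.I / 24),
    div_ne_zero (Complex.exp_ne_zero _) (Complex.exp_ne_zero _), fun τ => ?_⟩
  rw [HH, HH, theta_T, eta_T, mul_add, Complex.exp_add, mul_one,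
    show ((v : ℂ) - 1 / 2) * (τ + 1) + ((w : ℂ) - 1 / 2) + 1 / 2 =
      ((v : ℂ) - 1 / 2) * τ + (((v + w : ℝ) : ℂ) - 1 / 2) by push_cast; ring]
  rw [div_mul_div_comm]
  congr 1; ring

lemma csqrt_eq {z : ℂ} (hz : z ≠ 0) : Complex.sqrt z = cexp (Complex.log z * (2 : ℂ)⁻¹) := by
  rw [Complex.sqrt, Complex.cpow_def_of_ne_zero hz]

lemma sqrt_rel (τ : ℂ) (hτ : 0 < τ.im) :
    (-Complex.I * τ) ^ (1 / 2 : ℂ) = cexp (-(π * Complex.I / 4)) * Complex.sqrt τ := by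
  have h0 : τ ≠ 0 := by rintro rfl; simp at hτ
  have hI : (-Complex.I : ℂ) ≠ 0 := by simp
  have hlog : Complex.log (-Complex.I * τ) = Complex.log (-Complex.I) + Complex.log τ := by
    refine Complex.log_mul hI h0 ?_
    have h1 : 0 < τ.arg := by
      refine lt_of_le_of_ne (Complex.arg_nonneg_iff.mpr hτ.le) fun h => ?_
      have := (Complex.arg_eq_zero_iff.mp h.symm).2
      linarith
    rw [Complex.arg_neg_I]
    constructor
    · linarith [Real.pi_pos]
    · linarith [Real.pi_pos, Complex.arg_le_pi τ]
  rw [csqrt_eq h0, Complex.cpow_def_of_ne_zero (mul_ne_zero hI h0), hlog,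
    Complex.log_neg_I, ← Complex.exp_add]
  congr 1
  ring

lemma HH_S (v w : ℝ) : ∃ c : ℂ, c ≠ 0 ∧ ∀ τ : ℂ, 0 < τ.im →
    HH v w (-1 / τ) = c * HH w (-v) τ := by
  refine ⟨cexp (-(2 * π * Complex.I * ((v : ℂ) - 1 / 2) * ((w : ℂ) - 1 / 2))) *
    cexp (-(π * Complex.I / 4)) * (Complex.sqrt Complex.I), ?_, fun τ hτ => ?_⟩
  · refine mul_ne_zero (mul_ne_zero (Complex.exp_ne_zero _) (Complex.exp_ne_zero _)) ?_
    rw [csqrt_eq Complex.I_ne_zero]; exact Complex.exp_ne_zero _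
  have h0 : τ ≠ 0 := by rintro rfl; simp at hτ
  have hs0 : Complex.sqrt τ ≠ 0 := by rw [csqrt_eq h0]; exact Complex.exp_ne_zero _
  have hI0 : Complex.sqrt Complex.I ≠ 0 := by
    rw [csqrt_eq Complex.I_ne_zero]; exact Complex.exp_ne_zero _
  have he : ModularForm.eta (-1 / τ) =
      (Complex.sqrt Complex.I)⁻¹ * (Complex.sqrt τ * ModularForm.eta τ) := by
    simpa using ModularForm.eta_comp_eq_csqrt_I_inv (show τ ∈ upperHalfPlaneSet from hτ)
  have heta := ModularForm.eta_ne_zero (show τ ∈ upperHalfPlaneSet from hτ)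
  rw [← HH_add_one_right w (-v), HH, HH, he]
  have hth := jacobiTheta₂_functional_equation
    (((w : ℂ) - 1 / 2) * τ + (((-v + 1 : ℝ) : ℂ) - 1 / 2)) τ
  rw [sqrt_rel τ hτ] at hth
  rw [hth]
  have hz : (((w : ℂ) - 1 / 2) * τ + (((-v + 1 : ℝ) : ℂ) - 1 / 2)) / τ =
      ((v : ℂ) - 1 / 2) * (-1 / τ) + ((w : ℂ) - 1 / 2) := by
    push_cast; field_simp; ring
  rw [hz]
  generalize jacobiTheta₂ (((v : ℂ) - 1 / 2) * (-1 / τ) + ((w : ℂ) - 1 / 2)) (-1 / τ) = Th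
  have hexp : cexp (π * Complex.I * ((v : ℂ) - 1 / 2) ^ 2 * (-1 / τ)) =
      cexp (-(2 * π * Complex.I * ((v : ℂ) - 1 / 2) * ((w : ℂ) - 1 / 2))) *
      (cexp (π * Complex.I * ((w : ℂ) - 1 / 2) ^ 2 * τ) *
      cexp (-π * Complex.I * (((w : ℂ) - 1 / 2) * τ + (((-v + 1 : ℝ) : ℂ) - 1 / 2)) ^ 2 / τ)) := by
    rw [← Complex.exp_add, ← Complex.exp_add]
    congr 1
    push_cast; field_simp; ring
  rw [hexp]
  have := Complex.exp_ne_zero (-(π * Complex.I / 4))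
  field_simp

lemma HH_SL (A : SL(2, ℤ)) : ∀ v w : ℝ, ∃ c : ℂ, c ≠ 0 ∧ ∀ τ : ℍ,
    HH v w ((A • τ : ℍ) : ℂ) =
      c * HH (v * A.1 0 0 + w * A.1 1 0) (v * A.1 0 1 + w * A.1 1 1) τ := by
  have hA : A ∈ Subgroup.closure {ModularGroup.S, ModularGroup.T} := by
    simp [SpecialLinearGroup.SL2Z_generators]
  induction hA using Subgroup.closure_induction with
  | mem x hx =>
    intro v w
    rcases hx with rfl | rfl
    · obtain ⟨c, hc, h⟩ := HH_S v w
      refine ⟨c, hc, fun τ => ?_⟩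
      rw [UpperHalfPlane.modular_S_smul]
      have := h τ τ.im_pos
      simpa [ModularGroup.S, neg_div] using this
    · obtain ⟨c, hc, h⟩ := HH_T v w
      refine ⟨c, hc, fun τ => ?_⟩
      rw [UpperHalfPlane.modular_T_smul]
      have := h τ
      simpa [ModularGroup.T, add_comm] using this
  | one => exact fun v w => ⟨1, one_ne_zero, fun τ => by simp⟩
  | mul x y _ _ hx hy =>
    intro v w
    obtain ⟨c, hc, h⟩ := hx v w
    obtain ⟨d, hd, h'⟩ := hy (v * x.1 0 0 + w * x.1 1 0) (v * x.1 0 1 + w * x.1 1 1)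
    refine ⟨c * d, mul_ne_zero hc hd, fun τ => ?_⟩
    rw [mul_smul, h, h', mul_assoc]
    have e : ∀ i j, (((x * y).1 i j : ℤ) : ℝ) = x.1 i 0 * y.1 0 j + x.1 i 1 * y.1 1 j := by
      intro i j
      have hxy : (x * y).1 = x.1 * y.1 := rfl
      rw [hxy, Matrix.mul_apply, Fin.sum_univ_two]
      push_cast; ring
    rw [e, e, e, e]
    congr 3 <;> ring
  | inv x _ hx =>
    intro v w
    obtain ⟨c, hc, h⟩ := hx (v * x⁻¹.1 0 0 + w * x⁻¹.1 1 0) (v * x⁻¹.1 0 1 + w * x⁻¹.1 1 1)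
    refine ⟨c⁻¹, inv_ne_zero hc, fun τ => ?_⟩
    rw [eq_inv_mul_iff_mul_eq₀ hc]
    have := h (x⁻¹ • τ)
    rw [smul_inv_smul] at this
    rw [this]
    have hdet : (x.1 0 0 : ℝ) * x.1 1 1 - x.1 0 1 * x.1 1 0 = 1 := by
      have := x.det_coe
      rw [Matrix.det_fin_two] at this
      exact_mod_cast this
    congr 2
    · simp [SpecialLinearGroup.SL2_inv_expl]
      linear_combination (-v) * hdet
    · simp [SpecialLinearGroup.SL2_inv_expl]
      linear_combination (-w) * hdet

-- Behaviour at infinity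

lemma theta_asym (v w : ℝ) (hv0 : 0 ≤ v) (hv1 : v < 1) (hvw : ¬ (v = 0 ∧ ∃ n : ℤ, w = n))
    (f : ℝ → ℂ) (hf : Tendsto (fun y => (f y).im) atTop atTop) :
    ∃ κ : ℂ, κ ≠ 0 ∧ Tendsto (fun y => jacobiTheta₂ (((v : ℂ) - 1 / 2) * f y + ((w : ℂ) - 1 / 2))
      (f y)) atTop (𝓝 κ) := by
  have hq : ∀ n : ℤ, (n : ℝ) ^ 2 - |(n : ℝ)| ≤ (n : ℝ) ^ 2 + (2 * v - 1) * n := by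
    intro n
    have h1 : |(2 * v - 1) * (n : ℝ)| ≤ 1 * |(n : ℝ)| := by
      rw [abs_mul]
      gcongr
      rw [abs_le]; constructor <;> linarith
    linarith [(abs_le.mp h1).1]
  have hq0 : ∀ n : ℤ, 0 ≤ (n : ℝ) ^ 2 - |(n : ℝ)| := by
    intro n
    rcases eq_or_ne n 0 with rfl | h
    · simp
    · have : (1 : ℝ) ≤ |(n : ℝ)| := by exact_mod_cast Int.one_le_abs h
      have h2 := sq_abs (n : ℝ)
      nlinarith
  have hnorm : ∀ (n : ℤ) (y : ℝ), ‖jacobiTheta₂_term n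
      (((v : ℂ) - 1 / 2) * f y + ((w : ℂ) - 1 / 2)) (f y)‖ =
      rexp (-π * ((n : ℝ) ^ 2 + (2 * v - 1) * n) * (f y).im) := by
    intro n y
    rw [norm_jacobiTheta₂_term]
    congr 1
    have : ((((v : ℂ) - 1 / 2) * f y + ((w : ℂ) - 1 / 2))).im = (v - 1 / 2) * (f y).im := by
      rw [show ((v : ℂ) - 1 / 2) = ((v - 1 / 2 : ℝ) : ℂ) by push_cast; ring,
        show ((w : ℂ) - 1 / 2) = ((w - 1 / 2 : ℝ) : ℂ) by push_cast; ring,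
        Complex.add_im, Complex.im_ofReal_mul, Complex.ofReal_im, add_zero]
    rw [this]; ring
  have key := tendsto_tsum_of_dominated_convergence (𝓕 := (atTop : Filter ℝ))
    (f := fun y (n : ℤ) => jacobiTheta₂_term n
      (((v : ℂ) - 1 / 2) * f y + ((w : ℂ) - 1 / 2)) (f y))
    (g := fun n : ℤ => if (n : ℝ) ^ 2 + (2 * v - 1) * n = 0 then
      cexp (2 * π * Complex.I * n * ((w : ℂ) - 1 / 2)) else 0)
    (summable_pow_mul_jacobiTheta₂_term_bound (1 / 2) one_pos 0) ?_ ?_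
  · refine ⟨_, ?_, key⟩
    rw [tsum_eq_sum (s := ({0, 1} : Finset ℤ))]
    · rw [Finset.sum_pair (by norm_num)]
      simp only [Int.cast_zero, Int.cast_one]
      by_cases hv : v = 0
      · subst hv
        simp only [true_and, not_exists] at hvw
        norm_num
        intro h
        have h1 : cexp (2 * π * Complex.I * w) = 1 := by
          rw [show (2 * π * Complex.I * w : ℂ) = 2 * π * Complex.I * (w - 1 / 2) + π * Complex.I by
            ring, Complex.exp_add, Complex.exp_pi_mul_I]
          linear_combination -h
        obtain ⟨n, hn⟩ := Complex.exp_eq_one_iff.mp h1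
        apply hvw n
        have h2 : (2 * π * Complex.I : ℂ) ≠ 0 := Complex.two_pi_I_ne_zero
        have h3 : (w : ℂ) = n := mul_left_cancel₀ h2 (by rw [hn]; ring)
        exact_mod_cast h3
      · have h1 : ¬ ((1 : ℝ) ^ 2 + (2 * v - 1) * 1 = 0) := fun h => hv (by linarith)
        rw [if_neg h1]
        simp
    · intro n hn
      simp only [Finset.mem_insert, Finset.mem_singleton, not_or] at hn
      rw [if_neg]
      intro h
      have h2 : (n : ℝ) * (n + (2 * v - 1)) = 0 := by linarith
      rcases mul_eq_zero.mp h2 with h3 | h3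
      · exact hn.1 (by exact_mod_cast h3)
      · have h4 : (n : ℝ) ≤ 1 := by linarith
        have h5 : (-1 : ℝ) < n := by linarith
        have h6 : n ≤ 1 := by exact_mod_cast h4
        have h7 : -1 < n := by exact_mod_cast h5
        omega
  · intro n
    split_ifs with h
    · refine tendsto_const_nhds.congr fun y => ?_
      rw [jacobiTheta₂_term]
      congr 1
      have : (n : ℂ) ^ 2 + (2 * v - 1) * n = 0 := by exact_mod_cast h
      linear_combination (-(π * Complex.I * f y)) * this
    · rw [tendsto_zero_iff_norm_tendsto_zero]
      simp_rw [hnorm]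
      refine Real.tendsto_exp_atBot.comp ?_
      have hpos : 0 < (n : ℝ) ^ 2 + (2 * v - 1) * n :=
        lt_of_le_of_ne ((hq0 n).trans (hq n)) (Ne.symm h)
      refine Tendsto.const_mul_atTop_of_neg ?_ hf
      have := mul_pos Real.pi_pos hpos
      linarith
  · filter_upwards [tendsto_atTop.mp hf 1] with y hy n
    rw [hnorm, pow_zero, one_mul, Real.exp_le_exp]
    have h1 := hq n
    have h2 := hq0 n
    have h3 : (n : ℝ) ^ 2 - |(n : ℝ)| ≤ ((n : ℝ) ^ 2 + (2 * v - 1) * n) * (f y).im := by nlinarith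
    have h4 := mul_le_mul_of_nonneg_left h3 Real.pi_pos.le
    push_cast
    linarith

lemma eta_prod_tendsto (f : ℝ → ℂ) (hf : Tendsto (fun y => (f y).im) atTop atTop) :
    Tendsto (fun y => ∏' n, (1 - ModularForm.eta_q n (f y))) atTop (𝓝 1) := by
  have h1 : Tendsto (fun q : ℂ => ∏' n : ℕ, (1 - q ^ (n + 1))) (𝓝 0) (𝓝 1) := by
    have := (ModularForm.differentiableOn_tprod_one_sub_pow.differentiableAt
      (Metric.ball_mem_nhds (0 : ℂ) one_pos)).continuousAt.tendsto
    simpa using this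
  have h2 : Tendsto (fun y => cexp (2 * π * Complex.I * f y)) atTop (𝓝 0) := by
    rw [tendsto_zero_iff_norm_tendsto_zero]
    simp_rw [Complex.norm_exp]
    refine Real.tendsto_exp_atBot.comp ?_
    have h3 : ∀ y, (2 * π * Complex.I * f y).re = (-(2 * π)) * (f y).im := by
      intro y; simp
    simp_rw [h3]
    exact Tendsto.const_mul_atTop_of_neg (by linarith [Real.pi_pos]) hf
  refine (h1.comp h2).congr fun y => ?_
  simp [ModularForm.eta_q_eq_pow]

lemma HH_asym (v w : ℝ) (hv0 : 0 ≤ v) (hv1 : v < 1) (hvw : ¬ (v = 0 ∧ ∃ n : ℤ, w = n))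
    (f : ℝ → ℂ) (hf : Tendsto (fun y => (f y).im) atTop atTop) :
    ∃ κ : ℂ, κ ≠ 0 ∧ Tendsto (fun y => HH v w (f y) *
      cexp (-(π * Complex.I * ((v : ℂ) ^ 2 - v + 1 / 6) * f y))) atTop (𝓝 κ) := by
  obtain ⟨κ, hκ, h⟩ := theta_asym v w hv0 hv1 hvw f hf
  refine ⟨κ, hκ, ?_⟩
  have := h.div (eta_prod_tendsto f hf) one_ne_zero
  rw [div_one] at this
  refine this.congr fun y => ?_
  rw [Pi.div_apply, HH, ModularForm.eta, Function.Periodic.qParam]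
  have he : cexp (π * Complex.I * ((v : ℂ) - 1 / 2) ^ 2 * f y) =
      cexp (2 * π * Complex.I * f y / (24 : ℝ)) *
      (cexp (-(π * Complex.I * ((v : ℂ) ^ 2 - v + 1 / 6) * f y)))⁻¹ := by
    rw [← Complex.exp_neg, ← Complex.exp_add]; congr 1; push_cast; ring
  rw [he]
  have h1 := Complex.exp_ne_zero (2 * π * Complex.I * f y / (24 : ℝ))
  have h2 := Complex.exp_ne_zero (-(π * Complex.I * ((v : ℂ) ^ 2 - v + 1 / 6) * f y))
  field_simp

-- The unit in terms of theta

lemma prod_lem (l ρ r : ℤ) (h0 : 0 < ρ) (h1 : ρ < l) (hρ : ρ ≡ r [ZMOD l]) (f : ℤ → ℂ) :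
    ∏' n : {n : ℤ // 0 < n ∧ n ≡ r [ZMOD l]}, f n = ∏' k : ℕ, f (l * k + ρ) := by
  have hl : 0 < l := h0.trans h1
  let e : ℕ → {n : ℤ // 0 < n ∧ n ≡ r [ZMOD l]} := fun k => ⟨l * k + ρ, by positivity, by
    refine Int.ModEq.trans ?_ hρ
    rw [Int.modEq_iff_dvd]; exact ⟨-k, by ring⟩⟩
  have he : Function.Bijective e := by
    constructor
    · intro a b hab
      have : l * (a : ℤ) + ρ = l * b + ρ := congrArg Subtype.val hab
      have : (a : ℤ) = b := mul_left_cancel₀ hl.ne' (by linarith)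
      exact_mod_cast this
    · rintro ⟨n, hn0, hn⟩
      obtain ⟨k, hk⟩ := Int.modEq_iff_dvd.mp (hρ.trans hn.symm)
      have hk0 : 0 ≤ k := by
        by_contra hneg
        have : k ≤ -1 := by omega
        nlinarith
      refine ⟨k.toNat, Subtype.ext ?_⟩
      change l * (k.toNat : ℤ) + ρ = n
      rw [Int.toNat_of_nonneg hk0]; linarith
  exact ((Equiv.ofBijective e he).tprod_eq (fun n => f n)).symm

lemma inv_prod {p : ℂ} (hp1 : ‖p‖ < 1) (y : ℂ) (h : ∀ k : ℕ, ‖y * p ^ (2 * k + 1)‖ < 1) :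
    (∏' k : ℕ, (1 + y * p ^ (2 * k + 1))⁻¹) * ∏' k : ℕ, (1 + y * p ^ (2 * k + 1)) = 1 := by
  have hne : ∏' k : ℕ, (1 + y * p ^ (2 * k + 1)) ≠ 0 := by
    refine tprod_one_add_ne_zero_of_summable (fun k hk => ?_) (mult_factor hp1 y)
    have h2 := h k
    rw [(neg_eq_of_add_eq_zero_right hk).symm, norm_neg, norm_one] at h2
    exact lt_irrefl _ h2
  rw [((multipliable_one_add_of_summable (mult_factor hp1 y)).hasProd.inv₀ hne).tprod_eq]
  exact inv_mul_cancel₀ hne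

lemma rl_HH (l : ℕ) (r ρ : ℤ) (h0 : 0 < ρ) (h1 : ρ < l) (hρ : ρ ≡ r [ZMOD l]) (z : ℍ) :
    rl l r z * HH ((ρ : ℝ) / l) 0 ((l : ℂ) * z) = 1 := by
  have hl : (0 : ℤ) < l := h0.trans h1
  have hlR : (0 : ℝ) < l := by exact_mod_cast hl
  have hlC : (l : ℂ) ≠ 0 := by exact_mod_cast hlR.ne'
  have hfr : Int.fract ((r : ℝ) / (((l : ℕ) : ℤ) : ℝ)) = (ρ : ℝ) / l := by
    rw [Int.fract_eq_iff]
    refine ⟨by positivity, ?_, ?_⟩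
    · rw [div_lt_one hlR]; exact_mod_cast h1
    · obtain ⟨k, hk⟩ := Int.modEq_iff_dvd.mp hρ
      refine ⟨k, ?_⟩
      have : (r : ℝ) - ρ = l * k := by exact_mod_cast hk
      rw [Int.cast_natCast]
      field_simp
      linarith
  have hτ : 0 < ((l : ℂ) * z).im := by
    have : ((l : ℂ) * z).im = l * z.im := by simp
    rw [this]; exact mul_pos hlR z.im_pos
  have hexp1 : ∀ n : ℤ, 0 < n → ‖cexp (2 * π * Complex.I * n * z)‖ < 1 := by
    intro n hn
    rw [Complex.norm_exp, Real.exp_lt_one_iff]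
    have : (2 * π * Complex.I * n * z).re = -(2 * π * n * z.im) := by simp
    rw [this]
    have hn' : (0 : ℝ) < n := by exact_mod_cast hn
    have := z.im_pos
    have := Real.pi_pos
    simp only [neg_lt_zero]
    positivity
  have hp1 : ‖cexp (π * Complex.I * ((l : ℂ) * z))‖ < 1 := by
    rw [Complex.norm_exp, Real.exp_lt_one_iff]
    have : (π * Complex.I * ((l : ℂ) * z)).re = -(π * (l * z.im)) := by simp
    rw [this]
    have := z.im_pos
    have := Real.pi_pos
    simp only [neg_lt_zero]
    positivity
  rw [rl, prod_lem l ρ r h0 h1 hρ (fun n => (1 - cexp (2 * π * Complex.I * (n : ℂ) * z))⁻¹),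
    prod_lem l (l - ρ) (-r) (by linarith) (by linarith)
    ((Int.modEq_iff_dvd.mpr ⟨-1, by ring⟩ : ((l : ℤ) - ρ) ≡ -ρ [ZMOD l]).trans hρ.neg)
    (fun n => (1 - cexp (2 * π * Complex.I * (n : ℂ) * z))⁻¹)]
  rw [HH, jtp _ _ hτ, bern, hfr]
  set p := cexp (π * Complex.I * ((l : ℂ) * z)) with hp
  set x := cexp (2 * π * Complex.I * ((((ρ : ℝ) / l : ℝ) - 1 / 2 : ℂ) * ((l : ℂ) * z) +
    (((0 : ℝ) : ℂ) - 1 / 2))) with hx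
  have hm1 : (-1 : ℂ) = cexp (-(π * Complex.I)) := by
    rw [Complex.exp_neg, Complex.exp_pi_mul_I]; norm_num
  have hm1' : (-1 : ℂ) = cexp (π * Complex.I) := by
    rw [Complex.exp_pi_mul_I]
  have ex1 : ∀ k : ℕ, x * p ^ (2 * k + 1) =
      -cexp (2 * π * Complex.I * ((l * k + ρ : ℤ) : ℂ) * z) := by
    intro k
    rw [neg_eq_neg_one_mul, hm1, hx, hp, ← Complex.exp_nat_mul, ← Complex.exp_add,
      ← Complex.exp_add]
    congr 1; push_cast; field_simp; ring
  have ex2 : ∀ k : ℕ, x⁻¹ * p ^ (2 * k + 1) =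
      -cexp (2 * π * Complex.I * ((l * k + (l - ρ) : ℤ) : ℂ) * z) := by
    intro k
    rw [neg_eq_neg_one_mul, hm1', hx, hp, ← Complex.exp_nat_mul, ← Complex.exp_neg,
      ← Complex.exp_add, ← Complex.exp_add]
    congr 1; push_cast; field_simp; ring
  have P1 := inv_prod hp1 x (fun k => by
    rw [ex1, norm_neg]; exact hexp1 _ (by positivity))
  have P2 := inv_prod hp1 x⁻¹ (fun k => by
    rw [ex2, norm_neg]
    refine hexp1 _ ?_
    have : 0 < (l : ℤ) - ρ := by linarith
    positivity)
  have s1 : ∀ k : ℕ, 1 - cexp (2 * π * Complex.I * ((l * k + ρ : ℤ) : ℂ) * z) =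
      1 + x * p ^ (2 * k + 1) := fun k => by rw [ex1]; ring
  have s2 : ∀ k : ℕ, 1 - cexp (2 * π * Complex.I * ((l * k + (l - ρ) : ℤ) : ℂ) * z) =
      1 + x⁻¹ * p ^ (2 * k + 1) := fun k => by rw [ex2]; ring
  simp_rw [s1, s2]
  have hE : ∏' n, (1 - ModularForm.eta_q n ((l : ℂ) * z)) ≠ 0 := ModularForm.eta_tprod_ne_zero hτ
  rw [ModularForm.eta, Function.Periodic.qParam]
  simp_rw [ModularForm.eta_q_eq_pow] at hE ⊢
  generalize (∏' k : ℕ, (1 + x * p ^ (2 * k + 1))⁻¹) = U at *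
  generalize (∏' k : ℕ, (1 + x⁻¹ * p ^ (2 * k + 1))⁻¹) = V at *
  generalize (∏' k : ℕ, (1 + x * p ^ (2 * k + 1))) = U' at *
  generalize (∏' k : ℕ, (1 + x⁻¹ * p ^ (2 * k + 1))) = V' at *
  generalize (∏' n : ℕ, (1 - cexp (2 * π * Complex.I * ((l : ℂ) * z)) ^ (n + 1))) = E at *
  have hfin : cexp (2 * π * Complex.I *
      ((-((((l : ℕ) : ℤ) : ℝ) * (((ρ : ℝ) / l) ^ 2 - (ρ : ℝ) / l + 1 / 6) / 2) : ℝ) : ℂ) * z) *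
      cexp (π * Complex.I * ((((ρ : ℝ) / l : ℝ) : ℂ) - 1 / 2) ^ 2 * ((l : ℂ) * z)) =
      cexp (2 * π * Complex.I * ((l : ℂ) * z) / (24 : ℝ)) := by
    rw [← Complex.exp_add]; congr 1; push_cast; field_simp; ring
  rw [← mul_div_assoc, div_eq_one_iff_eq (mul_ne_zero (Complex.exp_ne_zero _) hE), ← hfin]
  generalize cexp _ = X1
  generalize cexp _ = X2
  linear_combination (X1 * X2 * E) * (U * U' * P2 + P1)

lemma exists_decomp (l : ℕ) (hl : 1 ≤ l) (A : SL(2, ℤ)) :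
    ∃ (γ : SL(2, ℤ)) (m u : ℤ), 0 < m ∧ (Int.gcd (A.1 1 0) l : ℤ) * m = l ∧
      γ.1 0 0 = m * A.1 0 0 ∧
      ∀ z : ℍ, ∃ τ : ℍ, (τ : ℂ) = ((Int.gcd (A.1 1 0) l : ℂ) * z + u) / m ∧
        ((γ • τ : ℍ) : ℂ) = (l : ℂ) * ((A • z : ℍ) : ℂ) := by
  have hdet : A.1 0 0 * A.1 1 1 - A.1 0 1 * A.1 1 0 = 1 := by
    have := A.det_coe
    rwa [Matrix.det_fin_two] at this
  obtain ⟨a, ha⟩ : ∃ a, a = A.1 0 0 := ⟨_, rfl⟩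
  obtain ⟨b, hb⟩ : ∃ b, b = A.1 0 1 := ⟨_, rfl⟩
  obtain ⟨c, hc⟩ : ∃ c, c = A.1 1 0 := ⟨_, rfl⟩
  obtain ⟨d, hd⟩ : ∃ d, d = A.1 1 1 := ⟨_, rfl⟩
  have hA : ∀ z : ℍ, ((A • z : ℍ) : ℂ) = ((a : ℂ) * z + b) / (c * z + d) := by
    intro z
    rw [UpperHalfPlane.specialLinearGroup_apply]
    simp [ha, hb, hc, hd]
  rw [← ha, ← hb, ← hc, ← hd] at hdet
  rw [← ha, ← hc]
  clear ha hb hc hd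
  have hbez := Int.gcd_eq_gcd_ab c l
  have ht0 : 0 < Int.gcd c l := Int.gcd_pos_of_ne_zero_right _ (by omega)
  obtain ⟨s, hs⟩ := Int.gcd_dvd_left (a := c) (b := (l : ℤ))
  obtain ⟨m, hm⟩ := Int.gcd_dvd_right (a := c) (b := (l : ℤ))
  generalize Int.gcd c l = t at *
  generalize Int.gcdA c l = e at *
  generalize Int.gcdB c l = f at *
  have ht : (0 : ℤ) < t := by exact_mod_cast ht0
  have hm0 : 0 < m := by
    have : (0 : ℤ) < t * m := by rw [← hm]; exact_mod_cast hl
    exact pos_of_mul_pos_right this ht.le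
  have co1 : IsCoprime m s := by
    refine ⟨f, e, mul_left_cancel₀ ht.ne' ?_⟩
    linear_combination (-1 : ℤ) * hbez - e * hs - f * hm
  have co2 : IsCoprime a s := ⟨d, -b * t, by linear_combination hdet + b * hs⟩
  obtain ⟨γ, hγ0, hγ1⟩ := (co1.mul_left co2).exists_SL2_col 0
  have hdetγ : γ.1 0 0 * γ.1 1 1 - γ.1 0 1 * γ.1 1 0 = 1 := by
    have := γ.det_coe
    rwa [Matrix.det_fin_two] at this
  obtain ⟨x, hx⟩ : ∃ x, x = γ.1 0 1 := ⟨_, rfl⟩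
  obtain ⟨w, hw⟩ : ∃ w, w = γ.1 1 1 := ⟨_, rfl⟩
  have hγ : ∀ z : ℍ, ((γ • z : ℍ) : ℂ) = (((m * a : ℤ) : ℂ) * z + x) / (s * z + w) := by
    intro z
    rw [UpperHalfPlane.specialLinearGroup_apply]
    simp [← hγ0, ← hγ1, hx, hw]
  rw [hγ0, hγ1, ← hx, ← hw] at hdetγ
  refine ⟨γ, m, w * l * b - x * d, hm0, hm.symm, hγ0, fun z => ?_⟩
  have hmR : (0 : ℝ) < m := by exact_mod_cast hm0
  have htR : (0 : ℝ) < t := by exact_mod_cast ht0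
  have hmC : (m : ℂ) ≠ 0 := by exact_mod_cast hm0.ne'
  obtain ⟨u, hu⟩ : ∃ u : ℤ, u = w * l * b - x * d := ⟨_, rfl⟩
  rw [← hu]
  have him : 0 < (((t : ℂ) * z + u) / m).im := by
    have : (((t : ℂ) * z + u) / m).im = t * z.im / m := by
      rw [show (m : ℂ) = ((m : ℝ) : ℂ) by simp, Complex.div_ofReal_im]
      simp
    rw [this]
    have := z.im_pos
    positivity
  refine ⟨⟨_, him⟩, rfl, ?_⟩
  rw [hγ, hA]
  have hden : (c : ℂ) * z + d ≠ 0 := by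
    intro h0
    have h1 := congrArg Complex.im h0
    have h2 := congrArg Complex.re h0
    simp at h1 h2
    rcases h1 with h1 | h1
    · rw [h1] at h2 hdet
      simp at h2
      simp [h2] at hdet
    · exact z.im_pos.ne' h1
  have e1 : (l : ℤ) * b = (m * a) * u + x * m := by
    rw [hu]
    linear_combination (-(l : ℤ) * b) * hdetγ + (x * m) * hdet + (x * m * b) * hs - (x * s * b) * hm
  have e2 : d = s * u + w * m := by
    rw [hu]
    linear_combination (-d) * hdetγ + (w * m) * hdet + (w * m * b) * hs - (s * w * b) * hm
  have e1' : (l : ℂ) * b = (m * a) * u + x * m := by exact_mod_cast e1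
  have e2' : (d : ℂ) = s * u + w * m := by exact_mod_cast e2
  have hs' : (c : ℂ) = t * s := by exact_mod_cast hs
  have hm' : (l : ℂ) = t * m := by exact_mod_cast hm
  have hden2 : (s : ℂ) * (((t : ℂ) * z + u) / m) + w = (c * z + d) / m := by
    rw [e2', hs']; field_simp; ring
  have hnum : (((m * a : ℤ) : ℂ) * (((t : ℂ) * z + u) / m) + x) = l * (a * z + b) / m := by
    rw [mul_add, e1', hm']; push_cast; field_simp; ring
  change (((m * a : ℤ) : ℂ) * (((t : ℂ) * z + u) / m) + x) /
    ((s : ℂ) * (((t : ℂ) * z + u) / m) + w) = _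
  rw [hden2, hnum]
  field_simp

/-- The order of `[r]_l` at the cusp `a/c` is `−(t²/(2l))·B(ar/t)` where `t = gcd(c,l)`:
`[r]_l(Az)·exp(2πi·(t²/(2l))·B(ar/t)·z)` tends to a nonzero constant as `z = iy`, `y → ∞`. -/
theorem sl2z_invariant_units_stmt10 (l : ℕ) (hl : 1 ≤ l) (r : ℤ) (hr : ¬ (l : ℤ) ∣ r)
    (A : SL(2, ℤ)) :
    ∃ κ : ℂ, κ ≠ 0 ∧
      Filter.Tendsto
        (fun y : ℝ => rl l r (A • iPt y) *
          Complex.exp (2 * (π : ℂ) * Complex.I *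
            ((((Int.gcd (A.1 1 0) l : ℝ) ^ 2 / (2 * (l : ℝ))) *
              bern (((A.1 0 0 * r : ℤ) : ℝ) / (Int.gcd (A.1 1 0) l : ℝ)) : ℝ) : ℂ) *
            ((iPt y : ℂ))))
        Filter.atTop (nhds κ) := by
  obtain ⟨γ, m, u, hm0, htm, hγ0, hdec⟩ := exists_decomp l hl A
  have ht0 : 0 < Int.gcd (A.1 1 0) l := Int.gcd_pos_of_ne_zero_right _ (by omega)
  generalize Int.gcd (A.1 1 0) l = t at *
  generalize A.1 0 0 = a at *
  have hl0 : (0 : ℤ) < l := by omega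
  have hlR : (0 : ℝ) < l := by exact_mod_cast hl0
  have hmR : (0 : ℝ) < m := by exact_mod_cast hm0
  have htR : (0 : ℝ) < t := by exact_mod_cast ht0
  have htmR : (t : ℝ) * m = l := by exact_mod_cast htm
  obtain ⟨ρ, hρ⟩ : ∃ ρ, ρ = r % (l : ℤ) := ⟨_, rfl⟩
  have hρ0 : 0 < ρ := by
    rw [hρ]
    exact lt_of_le_of_ne (Int.emod_nonneg _ hl0.ne')
      (fun h => hr (Int.dvd_of_emod_eq_zero h.symm))
  have hρ1 : ρ < l := by rw [hρ]; exact Int.emod_lt_of_pos _ hl0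
  have hρr : ρ ≡ r [ZMOD l] := by rw [hρ]; exact Int.mod_modEq _ _
  obtain ⟨V, hV⟩ : ∃ V : ℝ, V = (ρ : ℝ) / l * γ.1 0 0 := ⟨_, rfl⟩
  obtain ⟨W, hW⟩ : ∃ W : ℝ, W = (ρ : ℝ) / l * γ.1 0 1 := ⟨_, rfl⟩
  have hfr : Int.fract (((a * r : ℤ) : ℝ) / (t : ℝ)) = Int.fract V := by
    obtain ⟨k, hk⟩ := Int.modEq_iff_dvd.mp hρr
    rw [Int.fract_eq_fract]
    refine ⟨a * m * k, ?_⟩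
    have hk' : (r : ℝ) - ρ = l * k := by exact_mod_cast hk
    have hr' : (r : ℝ) = ρ + l * k := by linarith
    rw [hV, hγ0]
    push_cast
    rw [hr', ← htmR]
    field_simp
    ring
  obtain ⟨c1, hc1, h1⟩ := HH_SL γ ((ρ : ℝ) / l) 0
  simp only [zero_mul, add_zero] at h1
  rw [← hV, ← hW] at h1
  obtain ⟨c2, hc2, h2⟩ := HH_add_int_left (Int.fract V) W ⌊V⌋
  rw [Int.fract_add_floor] at h2
  choose T hT1 hT2 using hdec
  have him : Tendsto (fun y => ((T (iPt y) : ℍ) : ℂ).im) atTop atTop := by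
    have : ∀ y, ((T (iPt y) : ℍ) : ℂ).im = t / m * max y 1 := by
      intro y
      rw [hT1, show (m : ℂ) = ((m : ℝ) : ℂ) by simp, Complex.div_ofReal_im]
      simp [iPt]
      ring
    simp_rw [this]
    refine Tendsto.const_mul_atTop (by positivity) ?_
    exact tendsto_atTop_mono (fun y => le_max_left y 1) tendsto_id
  have hnon : ¬ (Int.fract V = 0 ∧ ∃ n : ℤ, W = n) := by
    rintro ⟨hV0, n, hn⟩
    have hV1 : V = ⌊V⌋ := by
      have := Int.fract_add_floor V
      rw [hV0] at this; linarith
    have hdetγ : (γ.1 0 0 : ℝ) * γ.1 1 1 - γ.1 0 1 * γ.1 1 0 = 1 := by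
      have := γ.det_coe
      rw [Matrix.det_fin_two] at this
      exact_mod_cast this
    have h3 : (ρ : ℝ) = l * ((⌊V⌋ * γ.1 1 1 - n * γ.1 1 0 : ℤ) : ℝ) := by
      push_cast
      rw [← hV1, ← hn, hV, hW]
      field_simp
      linear_combination (-1 : ℝ) * hdetγ
    have h4 : ρ = l * (⌊V⌋ * γ.1 1 1 - n * γ.1 1 0) := by exact_mod_cast h3
    have h5 : (l : ℤ) ∣ ρ := ⟨_, h4⟩
    exact absurd (Int.le_of_dvd hρ0 h5) (by omega)
  obtain ⟨κ, hκ, h3⟩ := HH_asym (Int.fract V) W (Int.fract_nonneg _) (Int.fract_lt_one _) hnon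
    (fun y => ((T (iPt y) : ℍ) : ℂ)) him
  obtain ⟨Bv, hBv⟩ : ∃ Bv : ℝ, Bv = Int.fract V ^ 2 - Int.fract V + 1 / 6 := ⟨_, rfl⟩
  have hbern : bern (((a * r : ℤ) : ℝ) / (t : ℝ)) = Bv := by rw [bern, hfr, hBv]
  have hBvC : ((Int.fract V : ℝ) : ℂ) ^ 2 - ((Int.fract V : ℝ) : ℂ) + 1 / 6 = (Bv : ℂ) := by
    rw [hBv]; push_cast; ring
  rw [hbern]
  simp only [hBvC] at h3
  have hmC : (m : ℂ) ≠ 0 := by exact_mod_cast hm0.ne'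
  have htC : (t : ℂ) ≠ 0 := by exact_mod_cast ht0.ne'
  have htmC : (l : ℂ) = t * m := by exact_mod_cast htm.symm
  refine ⟨(c1 * c2)⁻¹ * cexp (-(π * Complex.I * Bv * (u / m))) * κ⁻¹,
    mul_ne_zero (mul_ne_zero (inv_ne_zero (mul_ne_zero hc1 hc2)) (Complex.exp_ne_zero _))
      (inv_ne_zero hκ), ?_⟩
  refine ((h3.inv₀ hκ).const_mul _).congr fun y => ?_
  have hrl := rl_HH l r ρ hρ0 hρ1 hρr (A • iPt y)
  rw [← hT2, h1, h2] at hrl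
  have hne : HH (Int.fract V) W (T (iPt y)) ≠ 0 := by
    intro h0
    rw [h0] at hrl
    simp at hrl
  have hrl' : rl l r (A • iPt y) = (c1 * c2)⁻¹ * (HH (Int.fract V) W (T (iPt y)))⁻¹ := by
    rw [← mul_inv]
    refine eq_inv_of_mul_eq_one_left ?_
    rw [← hrl]; ring
  rw [hrl', mul_inv (HH (Int.fract V) W (T (iPt y))), ← Complex.exp_neg]
  have hexp : cexp (2 * π * Complex.I * (((t : ℝ) ^ 2 / (2 * (l : ℝ)) * Bv : ℝ) : ℂ) * (iPt y : ℂ)) =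
      cexp (-(π * Complex.I * Bv * (u / m))) *
      cexp (- -(π * Complex.I * Bv * (T (iPt y) : ℂ))) := by
    rw [← Complex.exp_add, hT1]
    congr 1
    push_cast
    rw [htmC]
    field_simp
    ring
  rw [hexp]
  ring
end
end
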